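/- arXiv:math/0508487 — 2 statements merged into one kernel-verified Lean document; each statement's English description precedes it below -/
import Mathlib

section
/- (Pecherskii–Rogozin identity.) For every α > 0, β ≥ 0 and q > 0 with q ≠ β, writing M(γ) = ∫_0^∞ α e^{−α t} E[e^{−γ X̄_t}] dt (the Laplace transform of X̄ at an independent exponential time of rate α), one has ∫_0^∞ e^{−q x} E[e^{−α τ_x^+ − β (X_{τ_x^+} − x)} 1_{{τ_x^+ < ∞}}] dx = (M(β) − M(q)) / ((q − β) M(β)). -/
open MeasureTheory ProbabilityTheory Set Filter
open scoped ENNReal NNReal Classical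

noncomputable section

namespace AKLevy

variable {Ω : Type*}

/-- Running supremum `X̄_t = sup_{0 ≤ s ≤ t} X_s` of a process. -/
def runSup (X : ℝ → Ω → ℝ) (t : ℝ) (ω : Ω) : ℝ :=
  sSup ((fun s => X s ω) '' Set.Icc 0 t)

/-- Running infimum `X̲_t = inf_{0 ≤ s ≤ t} X_s` of a process. -/
def runInf (X : ℝ → Ω → ℝ) (t : ℝ) (ω : Ω) : ℝ :=
  sInf ((fun s => X s ω) '' Set.Icc 0 t)

/-- All-time supremum `X̄_∞ = sup_{t ≥ 0} X_t`. -/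
def supAll (X : ℝ → Ω → ℝ) (ω : Ω) : ℝ :=
  sSup ((fun s => X s ω) '' Set.Ici 0)

/-- All-time infimum `X̲_∞ = inf_{t ≥ 0} X_t`. -/
def infAll (X : ℝ → Ω → ℝ) (ω : Ω) : ℝ :=
  sInf ((fun s => X s ω) '' Set.Ici 0)

/-- `X` is a real-valued Lévy process with respect to the filtration `ℱ`,
on a filtered probability space satisfying the usual conditions. -/
structure IsLevy [m0 : MeasurableSpace Ω] (P : Measure Ω) (ℱ : Filtration ℝ m0)
    (X : ℝ → Ω → ℝ) : Prop where
  isProb : IsProbabilityMeasure P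
  adapted : ∀ t : ℝ, 0 ≤ t → StronglyMeasurable[ℱ t] (X t)
  zero : ∀ᵐ ω ∂P, X 0 ω = 0
  rightCont : ∀ ω, ∀ t : ℝ, 0 ≤ t → ContinuousWithinAt (fun s => X s ω) (Set.Ici t) t
  leftLim : ∀ ω, ∀ t : ℝ, 0 < t →
    ∃ l : ℝ, Tendsto (fun s => X s ω) (nhdsWithin t (Set.Iio t)) (nhds l)
  indepIncrements : ∀ s t : ℝ, 0 ≤ s → s ≤ t →
    Indep (MeasurableSpace.comap (fun ω => X t ω - X s ω) inferInstance) (ℱ s) P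
  stationary : ∀ s t : ℝ, 0 ≤ s → s ≤ t →
    Measure.map (fun ω => X t ω - X s ω) P = Measure.map (X (t - s)) P
  filtRightCont : ∀ t : ℝ, (ℱ t : MeasurableSpace Ω) = ⨅ s ∈ Set.Ioi t, (ℱ s : MeasurableSpace Ω)
  complete : ∀ N : Set Ω, MeasurableSet N → P N = 0 → MeasurableSet[ℱ 0] N

/-- `τ_x^+ < ∞`: the process passes strictly above level `x` at some nonnegative time. -/
def hitsAbove (X : ℝ → Ω → ℝ) (x : ℝ) (ω : Ω) : Prop := ∃ t, 0 ≤ t ∧ x < X t ω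

/-- First passage time above `x`:  `τ_x^+ = inf {t ≥ 0 : X_t > x}` (junk value if never). -/
def tauAbove (X : ℝ → Ω → ℝ) (x : ℝ) (ω : Ω) : ℝ := sInf {t : ℝ | 0 ≤ t ∧ x < X t ω}

/-- `τ_x^- < ∞`: the process passes strictly below level `x` at some nonnegative time. -/
def hitsBelow (X : ℝ → Ω → ℝ) (x : ℝ) (ω : Ω) : Prop := ∃ t, 0 ≤ t ∧ X t ω < x

/-- First passage time below `x`:  `τ_x^- = inf {t ≥ 0 : X_t < x}` (junk value if never). -/
def tauBelow (X : ℝ → Ω → ℝ) (x : ℝ) (ω : Ω) : ℝ := sInf {t : ℝ | 0 ≤ t ∧ X t ω < x}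

/-- The `[0,∞]`-valued first passage time `σ_x = inf { t ≥ 0 : x + X_t < y }`, with `inf ∅ = ∞`. -/
def hitBelowE (X : ℝ → Ω → ℝ) (y x : ℝ) (ω : Ω) : ℝ≥0∞ :=
  if ∃ t, 0 ≤ t ∧ x + X t ω < y then ENNReal.ofReal (sInf {t : ℝ | 0 ≤ t ∧ x + X t ω < y})
  else ∞

/-- The stopped clock `t ∧ σ_x` (real-valued), where `σ_x = inf{ t ≥ 0 : x + X_t < y}`. -/
def stoppedClock (X : ℝ → Ω → ℝ) (y x : ℝ) (t : ℝ) (ω : Ω) : ℝ :=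
  (min (ENNReal.ofReal t) (hitBelowE X y x ω)).toReal

/-- A `[0,∞]`-valued stopping time of the filtration `ℱ`. -/
def IsStopTime [m0 : MeasurableSpace Ω] (ℱ : Filtration ℝ m0) (τ : Ω → ℝ≥0∞) : Prop :=
  ∀ t : ℝ, 0 ≤ t → MeasurableSet[ℱ t] {ω | τ ω ≤ ENNReal.ofReal t}

/-- Discounted payoff `e^{-rτ} G(x + X_τ)` at a `[0,∞]`-valued time `τ`, set to `0` on `{τ = ∞}`. -/
def stopPayoff (X : ℝ → Ω → ℝ) (r x : ℝ) (G : ℝ → ℝ) (τ : Ω → ℝ≥0∞) (ω : Ω) : ℝ :=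
  if τ ω ≠ ∞ then Real.exp (-(r * (τ ω).toReal)) * G (x + X ((τ ω).toReal) ω) else 0

/-- Discounted American put payoff `e^{-rτ}(K - e^{x + X_τ})^+ 1_{τ < ∞}`. -/
def putPayoff (X : ℝ → Ω → ℝ) (r K x : ℝ) (τ : Ω → ℝ≥0∞) (ω : Ω) : ℝ :=
  stopPayoff X r x (fun z => max (K - Real.exp z) 0) τ ω

/-- Value function `v(x) = sup_τ E[e^{-rτ}(K - e^{x+X_τ})^+ 1_{τ<∞}]`, the supremum
being over all `[0,∞]`-valued stopping times of `ℱ`. -/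
def putValue [m0 : MeasurableSpace Ω] (P : Measure Ω) (ℱ : Filtration ℝ m0)
    (X : ℝ → Ω → ℝ) (r K x : ℝ) : ℝ :=
  ⨆ τ : {τ : Ω → ℝ≥0∞ // IsStopTime ℱ τ}, ∫ ω, putPayoff X r K x τ.1 ω ∂P

/-- `m = E[e^{X̲_{e_r}}]`, where `e_r` is an independent exponential time of rate `r > 0`,
and `e_0 = ∞`. -/
def mInf [m0 : MeasurableSpace Ω] (P : Measure Ω) (X : ℝ → Ω → ℝ) (r : ℝ) : ℝ :=
  if 0 < r then
    ∫ t in Set.Ioi (0 : ℝ), r * Real.exp (-(r * t)) * (∫ ω, Real.exp (runInf X t ω) ∂P)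
  else ∫ ω, Real.exp (infAll X ω) ∂P

/-- `P(X̲_{e_r} = 0)`, where `e_r` is an independent exponential time of rate `r > 0`,
and `e_0 = ∞`. -/
def atomZeroProb [m0 : MeasurableSpace Ω] (P : Measure Ω) (X : ℝ → Ω → ℝ) (r : ℝ) : ℝ :=
  if 0 < r then
    ∫ t in Set.Ioi (0 : ℝ), r * Real.exp (-(r * t)) * (P {ω | runInf X t ω = 0}).toReal
  else (P {ω | infAll X ω = 0}).toReal

/-- The event `{τ_0^- = 0}`: `0` is (pathwise) immediately reached from below, i.e.
`inf{t ≥ 0 : X_t < 0} = 0`. -/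
def regularBelow (X : ℝ → Ω → ℝ) : Set Ω :=
  {ω | ∀ ε > (0 : ℝ), ∃ t, 0 ≤ t ∧ t < ε ∧ X t ω < 0}

/-- `E[e^{-γ X̄_{e_α}}] = ∫_0^∞ α e^{-α t} E[e^{-γ X̄_t}] dt`. -/
def expSupLT [m0 : MeasurableSpace Ω] (P : Measure Ω) (X : ℝ → Ω → ℝ) (α γ : ℝ) : ℝ :=
  ∫ t in Set.Ioi (0 : ℝ), α * Real.exp (-(α * t)) * (∫ ω, Real.exp (-(γ * runSup X t ω)) ∂P)

/-- The function `h_{α,β}(x) = E[e^{-α σ_x + β (x + X_{σ_x})} 1_{σ_x < ∞}]`, where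
`σ_x = inf{t ≥ 0 : x + X_t < 0}`. -/
def hAB [m0 : MeasurableSpace Ω] (P : Measure Ω) (X : ℝ → Ω → ℝ) (α β : ℝ) (z : ℝ) : ℝ :=
  ∫ ω, (if hitsBelow X (-z) ω then
      Real.exp (-(α * tauBelow X (-z) ω) + β * (z + X (tauBelow X (-z) ω) ω)) else 0) ∂P

/-- `v_y(x) = E[e^{-r σ_x} (K - e^{x + X_{σ_x}})^+ 1_{σ_x<∞}]` where
`σ_x = inf{t ≥ 0 : x + X_t < y}`. -/
def vy [m0 : MeasurableSpace Ω] (P : Measure Ω) (X : ℝ → Ω → ℝ) (r K y : ℝ) (z : ℝ) : ℝ :=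
  ∫ ω, putPayoff X r K z (hitBelowE X y z) ω ∂P

/-- The process `f` (indexed by `t ≥ 0`) is a martingale with respect to `ℱ` and `P`. -/
def MartOn [m0 : MeasurableSpace Ω] (P : Measure Ω) (ℱ : Filtration ℝ m0)
    (f : ℝ → Ω → ℝ) : Prop :=
  (∀ t : ℝ, 0 ≤ t → StronglyMeasurable[ℱ t] (f t)) ∧
  (∀ t : ℝ, 0 ≤ t → Integrable (f t) P) ∧
  ∀ s t : ℝ, 0 ≤ s → s ≤ t → P[f t|ℱ s] =ᵐ[P] f s

/-- The process `f` (indexed by `t ≥ 0`) is a supermartingale w.r.t. `ℱ` and `P`. -/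
def SupermartOn [m0 : MeasurableSpace Ω] (P : Measure Ω) (ℱ : Filtration ℝ m0)
    (f : ℝ → Ω → ℝ) : Prop :=
  (∀ t : ℝ, 0 ≤ t → StronglyMeasurable[ℱ t] (f t)) ∧
  (∀ t : ℝ, 0 ≤ t → Integrable (f t) P) ∧
  ∀ s t : ℝ, 0 ≤ s → s ≤ t → P[f t|ℱ s] ≤ᵐ[P] f s

/-- A real random walk adapted to a discrete filtration: its increments are identically distributed
and independent of the past, and it starts at `0`. -/
structure IsRandomWalk [m0 : MeasurableSpace Ω] (P : Measure Ω) (𝒢 : Filtration ℕ m0)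
    (S : ℕ → Ω → ℝ) : Prop where
  adapted : ∀ j, Measurable[𝒢 j] (S j)
  indep : ∀ j, Indep (MeasurableSpace.comap (fun ω => S (j + 1) ω - S j ω) inferInstance) (𝒢 j) P
  ident : ∀ j, Measure.map (fun ω => S (j + 1) ω - S j ω) P =
    Measure.map (fun ω => S 1 ω - S 0 ω) P
  zero : ∀ᵐ ω ∂P, S 0 ω = 0

/-- The running maximum of the sequence `s` restarted at time `j`, relative to the value `s j`. -/
def restartMax (s : ℕ → ℝ) (j m : ℕ) : ℝ := partialSups (fun i => s (j + i) - s j) m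

lemma restartMax_zero (s : ℕ → ℝ) (j : ℕ) : restartMax s j 0 = 0 := by
  simp [restartMax]

lemma restartMax_succ (s : ℕ → ℝ) (j m : ℕ) :
    restartMax s j (m + 1) = max 0 ((s (j + 1) - s j) + restartMax s (j + 1) m) := by
  induction m with
  | zero => simpa [restartMax] using partialSups_add_one (fun i => s (j + i) - s j) 0
  | succ m ih =>
    have h1 : restartMax s j (m + 1 + 1) =
        max (restartMax s j (m + 1)) (s (j + (m + 1 + 1)) - s j) :=
      partialSups_add_one _ _
    have h2 : restartMax s (j + 1) (m + 1) =
        max (restartMax s (j + 1) m) (s (j + 1 + (m + 1)) - s (j + 1)) :=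
      partialSups_add_one _ _
    rw [h1, h2, ih, ← max_add_add_left, ← max_assoc]
    congr 1
    rw [show j + (m + 1 + 1) = j + 1 + (m + 1) by ring]
    ring

lemma restartMax_nonneg (s : ℕ → ℝ) (j m : ℕ) : 0 ≤ restartMax s j m := by
  have := le_partialSups_of_le (fun i => s (j + i) - s j) (Nat.zero_le m)
  simpa [restartMax] using this

lemma partialSups_eq_restartMax {s : ℕ → ℝ} (h0 : s 0 = 0) (k : ℕ) :
    partialSups s k = restartMax s 0 k := by
  simp [restartMax, h0]

lemma partialSups_add_eq_add_restartMax {s : ℕ → ℝ} {a : ℕ} (ha : partialSups s a = s a) (m : ℕ) :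
    partialSups s (a + m) = s a + restartMax s a m := by
  induction m with
  | zero => simp [restartMax_zero, ha]
  | succ m ih =>
    have h2 : restartMax s a (m + 1) = max (restartMax s a m) (s (a + (m + 1)) - s a) :=
      partialSups_add_one _ _
    rw [h2, ← add_assoc, partialSups_add_one, ih, ← max_add_add_left]
    congr 1
    rw [add_assoc]
    ring

/-- Decomposition of a function of the running maximum along the successive record times. -/
lemma exp_mul_partialSups_eq_sum {s : ℕ → ℝ} (h0 : s 0 = 0) (β : ℝ) {F : ℝ → ℝ} (hF : F 0 = 0)
    (k : ℕ) :
    Real.exp (-(β * partialSups s k)) * F (partialSups s k) =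
      ∑ j ∈ Finset.range k, Real.exp (-(β * s (j + 1))) *
        (F (partialSups s (j + 1)) - F (partialSups s j)) *
          Real.exp (-(β * restartMax s (j + 1) (k - (j + 1)))) := by
  have key : ∀ j ∈ Finset.range k, Real.exp (-(β * s (j + 1))) *
        (F (partialSups s (j + 1)) - F (partialSups s j)) *
          Real.exp (-(β * restartMax s (j + 1) (k - (j + 1)))) =
      Real.exp (-(β * partialSups s k)) * (F (partialSups s (j + 1)) - F (partialSups s j)) := by
    intro j hj
    have hj' : j + 1 ≤ k := Finset.mem_range.mp hj
    rcases le_total (s (j + 1)) (partialSups s j) with h | h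
    · have : partialSups s (j + 1) = partialSups s j := by
        rw [partialSups_add_one]; exact max_eq_left h
      rw [this]; simp
    · have hrec : partialSups s (j + 1) = s (j + 1) := by
        rw [partialSups_add_one]; exact max_eq_right h
      have hk := partialSups_add_eq_add_restartMax hrec (k - (j + 1))
      rw [Nat.add_sub_cancel' hj'] at hk
      rw [hk, mul_add, neg_add, Real.exp_add]
      ring
  rw [Finset.sum_congr rfl key, ← Finset.mul_sum,
    Finset.sum_range_sub (fun j => F (partialSups s j))]
  simp [h0, hF]

lemma measurable_partialSups_apply {m : MeasurableSpace Ω} {S : ℕ → Ω → ℝ} {k : ℕ}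
    (hS : ∀ i ≤ k, Measurable (S i)) :
    Measurable (fun ω => partialSups (fun i => S i ω) k) := by
  induction k with
  | zero => simpa using hS 0 le_rfl
  | succ k ih =>
    simp_rw [partialSups_add_one]
    exact (ih fun i hi => hS i (hi.trans k.le_succ)).max (hS _ le_rfl)

lemma measurable_restartMax {m : MeasurableSpace Ω} {S : ℕ → Ω → ℝ}
    (hS : ∀ i, Measurable (S i)) (j k : ℕ) :
    Measurable (fun ω => restartMax (fun i => S i ω) j k) :=
  measurable_partialSups_apply (S := fun i ω => S (j + i) ω - S j ω)
    fun _ _ => (hS _).sub (hS _)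

section RandomWalk

variable [m0 : MeasurableSpace Ω] {P : Measure Ω} {𝒢 : Filtration ℕ m0} {S : ℕ → Ω → ℝ}

lemma IsRandomWalk.measurable (hS : IsRandomWalk P 𝒢 S) (j : ℕ) : Measurable (S j) :=
  (hS.adapted j).mono (𝒢.le j) le_rfl

lemma IsRandomWalk.measurable_of_le (hS : IsRandomWalk P 𝒢 S) {i j : ℕ} (h : i ≤ j) :
    Measurable[𝒢 j] (S i) :=
  (hS.adapted i).mono (𝒢.mono h) le_rfl

/-- Weak Markov property: the maximum of the walk restarted at time `j` is independent of the past
and its law does not depend on `j`. -/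
lemma IsRandomWalk.indep_restartMax [IsProbabilityMeasure P] (hS : IsRandomWalk P 𝒢 S) (m : ℕ) :
    ∀ j, Indep (MeasurableSpace.comap (fun ω => restartMax (fun i => S i ω) j m) inferInstance)
        (𝒢 j) P ∧
      Measure.map (fun ω => restartMax (fun i => S i ω) j m) P =
        Measure.map (fun ω => restartMax (fun i => S i ω) 0 m) P := by
  induction m with
  | zero =>
    intro j
    simp only [restartMax_zero, MeasurableSpace.comap_const, and_true]
    exact indep_bot_left _
  | succ m ih =>
    let f : ℝ × ℝ → ℝ := fun p => max 0 (p.1 + p.2)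
    have hf : Measurable f := by fun_prop
    let μ := Measure.map (fun ω => S 1 ω - S 0 ω) P
    let ν := Measure.map (fun ω => restartMax (fun i => S i ω) 0 m) P
    have hξ : ∀ j, Measurable (fun ω => S (j + 1) ω - S j ω) := fun j =>
      (hS.measurable _).sub (hS.measurable _)
    have hG : ∀ j k, Measurable (fun ω => restartMax (fun i => S i ω) j k) :=
      measurable_restartMax hS.measurable
    have : IsProbabilityMeasure μ := Measure.isProbabilityMeasure_map (hξ 0).aemeasurable
    have : IsProbabilityMeasure ν := Measure.isProbabilityMeasure_map (hG 0 m).aemeasurable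
    have key : ∀ j (A : Set Ω), MeasurableSet[𝒢 j] A → ∀ B, MeasurableSet B →
        P ((fun ω => restartMax (fun i => S i ω) j (m + 1)) ⁻¹' B ∩ A) =
          P A * (μ.prod ν) (f ⁻¹' B) := by
      intro j A hA B hB
      have hA' : MeasurableSet A := 𝒢.le j _ hA
      have hpair : Measurable (fun ω => (S (j + 1) ω - S j ω,
          restartMax (fun i => S i ω) (j + 1) m)) := (hξ j).prodMk (hG _ _)
      have hprod : (P A • μ).prod ν = Measure.map (fun ω => (S (j + 1) ω - S j ω,
          restartMax (fun i => S i ω) (j + 1) m)) (P.restrict A) := by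
        have : IsFiniteMeasure (P A • μ) := Measure.smul_finite μ (measure_ne_top P A)
        refine Measure.prod_eq fun s t hs ht => ?_
        rw [Measure.map_apply hpair (hs.prod ht), Measure.restrict_apply (hpair (hs.prod ht))]
        have hset : (fun ω => (S (j + 1) ω - S j ω, restartMax (fun i => S i ω) (j + 1) m)) ⁻¹'
            s ×ˢ t ∩ A = (fun ω => restartMax (fun i => S i ω) (j + 1) m) ⁻¹' t ∩
              ((fun ω => S (j + 1) ω - S j ω) ⁻¹' s ∩ A) := by
          ext ω; simp only [mem_inter_iff, mem_preimage, mem_prod]; tauto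
        have hms : MeasurableSet[𝒢 (j + 1)] ((fun ω => S (j + 1) ω - S j ω) ⁻¹' s ∩ A) := by
          refine MeasurableSet.inter ?_ (𝒢.mono j.le_succ _ hA)
          exact ((hS.adapted _).sub (hS.measurable_of_le j.le_succ)) hs
        rw [hset, (Indep_iff _ _ _).1 (ih (j + 1)).1 _ _ ⟨t, ht, rfl⟩ hms,
          (Indep_iff _ _ _).1 (hS.indep j) _ _ ⟨s, hs, rfl⟩ hA, Measure.smul_apply, smul_eq_mul,
          ← Measure.map_apply (hG _ _) ht, ← Measure.map_apply (hξ _) hs, (ih (j + 1)).2,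
          hS.ident j]
        ring
      have hrw : (fun ω => restartMax (fun i => S i ω) j (m + 1)) =
          f ∘ fun ω => (S (j + 1) ω - S j ω, restartMax (fun i => S i ω) (j + 1) m) := by
        ext ω; exact restartMax_succ _ _ _
      rw [hrw, preimage_comp, ← Measure.restrict_apply (hpair (hf hB)),
        ← Measure.map_apply hpair (hf hB), ← hprod, Measure.prod_smul_left, Measure.smul_apply,
        smul_eq_mul]
    have hlaw : ∀ j B, MeasurableSet B →
        P ((fun ω => restartMax (fun i => S i ω) j (m + 1)) ⁻¹' B) = (μ.prod ν) (f ⁻¹' B) := by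
      intro j B hB
      simpa using key j univ MeasurableSet.univ B hB
    intro j
    constructor
    · rw [Indep_iff]
      rintro _ A ⟨B, hB, rfl⟩ hA
      rw [key j A hA B hB, hlaw j B hB, mul_comm]
    · ext B hB
      rw [Measure.map_apply (hG _ _) hB, Measure.map_apply (hG _ _) hB, hlaw j B hB, hlaw 0 B hB]

lemma IsRandomWalk.integral_mul_restartMax [IsProbabilityMeasure P] (hS : IsRandomWalk P 𝒢 S)
    (j m : ℕ) {Y : Ω → ℝ} (hY : Measurable[𝒢 j] Y) {h : ℝ → ℝ} (hh : Measurable h) :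
    ∫ ω, Y ω * h (restartMax (fun i => S i ω) j m) ∂P =
      (∫ ω, Y ω ∂P) * ∫ ω, h (partialSups (fun i => S i ω) m) ∂P := by
  have hG := measurable_restartMax hS.measurable
  have hind : IndepFun Y (fun ω => h (restartMax (fun i => S i ω) j m)) P := by
    have h1 : IndepFun Y (fun ω => restartMax (fun i => S i ω) j m) P :=
      (indep_of_indep_of_le_right (hS.indep_restartMax m j).1 hY.comap_le).symm
    exact h1.comp measurable_id hh
  rw [hind.integral_fun_mul_eq_mul_integral (hY.mono (𝒢.le j) le_rfl).aestronglyMeasurable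
    (hh.comp (hG j m)).aestronglyMeasurable]
  congr 1
  rw [← integral_map (hG j m).aemeasurable hh.aestronglyMeasurable,
    (hS.indep_restartMax m j).2, integral_map (hG 0 m).aemeasurable hh.aestronglyMeasurable]
  refine integral_congr_ae ?_
  filter_upwards [hS.zero] with ω hω
  rw [partialSups_eq_restartMax hω]

end RandomWalk

/-- The `j`-th term of the discounted overshoot at the first passage of the sequence `s` above the
level `x`; it vanishes unless the passage happens at the index `j + 1`. -/
def passageTerm (s : ℕ → ℝ) (q β ρ x : ℝ) (j : ℕ) : ℝ :=
  if partialSups s j ≤ x ∧ x < s (j + 1) then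
    ρ ^ (j + 1) * (Real.exp (-(q * x)) * Real.exp (-(β * (s (j + 1) - x)))) else 0

lemma passageTerm_nonneg (s : ℕ → ℝ) (q β x : ℝ) {ρ : ℝ} (hρ : 0 ≤ ρ) (j : ℕ) :
    0 ≤ passageTerm s q β ρ x j := by
  unfold passageTerm
  split_ifs <;> positivity

lemma passageTerm_le (s : ℕ → ℝ) (q x : ℝ) {β ρ : ℝ} (hβ : 0 ≤ β) (hρ : 0 ≤ ρ) (j : ℕ) :
    passageTerm s q β ρ x j ≤ ρ ^ (j + 1) * Real.exp (-(q * x)) := by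
  unfold passageTerm
  split_ifs with h
  · refine mul_le_mul_of_nonneg_left (mul_le_of_le_one_right (by positivity) ?_) (by positivity)
    exact Real.exp_le_one_iff.2 (neg_nonpos.2 (mul_nonneg hβ (sub_nonneg.2 h.2.le)))
  · positivity

/-- The primitive `y ↦ ∫ x in 0..y, exp (-(c * x))` for `c ≠ 0`. -/
def expPrimitive (c y : ℝ) : ℝ := (1 - Real.exp (-(c * y))) / c

lemma hasDerivAt_expPrimitive {c : ℝ} (hc : c ≠ 0) (y : ℝ) :
    HasDerivAt (expPrimitive c) (Real.exp (-(c * y))) y := by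
  have h1 : HasDerivAt (fun y : ℝ => -(c * y)) (-(c * 1)) y :=
    ((hasDerivAt_id y).const_mul c).neg
  convert! (h1.exp.const_sub 1).div_const c using 1
  field_simp

lemma intervalIntegral_exp_neg_mul {c : ℝ} (hc : c ≠ 0) (a b : ℝ) :
    ∫ x in a..b, Real.exp (-(c * x)) = expPrimitive c b - expPrimitive c a :=
  intervalIntegral.integral_eq_sub_of_hasDerivAt (fun y _ => hasDerivAt_expPrimitive hc y)
    ((by fun_prop : Continuous fun x => Real.exp (-(c * x))).intervalIntegrable _ _)

lemma exp_mul_expPrimitive {q β : ℝ} (y : ℝ) :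
    Real.exp (-(β * y)) * expPrimitive (q - β) y =
      (Real.exp (-(β * y)) - Real.exp (-(q * y))) / (q - β) := by
  rw [expPrimitive, mul_div_assoc', mul_sub, mul_one, ← Real.exp_add]
  ring_nf

lemma integral_passageTerm {s : ℕ → ℝ} (h0 : s 0 = 0) {q β : ℝ} (hqβ : q ≠ β) (ρ : ℝ) (j : ℕ) :
    ∫ x in Ioi (0 : ℝ), passageTerm s q β ρ x j =
      ρ ^ (j + 1) * (Real.exp (-(β * s (j + 1))) *
        (expPrimitive (q - β) (partialSups s (j + 1)) - expPrimitive (q - β) (partialSups s j))) := by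
  have hM : 0 ≤ partialSups s j := by
    simpa [h0] using le_partialSups_of_le s (Nat.zero_le j)
  have hind : (fun x => passageTerm s q β ρ x j) = (Ico (partialSups s j) (s (j + 1))).indicator
      (fun x => ρ ^ (j + 1) * Real.exp (-(β * s (j + 1))) * Real.exp (-((q - β) * x))) := by
    ext x
    simp only [passageTerm, indicator_apply, mem_Ico]
    congr 1
    rw [mul_assoc, ← Real.exp_add, ← Real.exp_add]
    ring_nf
  rw [← integral_Ici_eq_integral_Ioi, hind, setIntegral_indicator measurableSet_Ico,
    inter_eq_self_of_subset_right (Ico_subset_Ici_self.trans (Ici_subset_Ici.2 hM)),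
    integral_const_mul, mul_assoc]
  congr 2
  rcases le_total (s (j + 1)) (partialSups s j) with h | h
  · have : partialSups s (j + 1) = partialSups s j := by
      rw [partialSups_add_one]; exact max_eq_left h
    simp [this, Ico_eq_empty (not_lt.2 h)]
  · have : partialSups s (j + 1) = s (j + 1) := by
      rw [partialSups_add_one]; exact max_eq_right h
    rw [this, integral_Ico_eq_integral_Ioc, ← intervalIntegral.integral_of_le h,
      intervalIntegral_exp_neg_mul (sub_ne_zero.2 hqβ)]

section RandomWalk

variable [m0 : MeasurableSpace Ω] {P : Measure Ω} {𝒢 : Filtration ℕ m0} {S : ℕ → Ω → ℝ}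

lemma integrable_exp_neg_mul_fst (P : Measure Ω) [IsProbabilityMeasure P] {q : ℝ} (hq : 0 < q) :
    Integrable (fun p : ℝ × Ω => Real.exp (-(q * p.1)))
      ((volume.restrict (Ioi (0 : ℝ))).prod P) := by
  have h : Integrable (fun x : ℝ => Real.exp (-(q * x))) (volume.restrict (Ioi (0 : ℝ))) := by
    simpa only [neg_mul] using (exp_neg_integrableOn_Ioi 0 hq).integrable
  exact h.comp_fst P

lemma measurable_passageTerm (hS : ∀ i, Measurable (S i)) (q β ρ : ℝ) (j : ℕ) :
    Measurable (fun p : ℝ × Ω => passageTerm (fun i => S i p.2) q β ρ p.1 j) := by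
  have h1 : Measurable (fun p : ℝ × Ω => partialSups (fun i => S i p.2) j) :=
    (measurable_partialSups_apply fun i _ => hS i).comp measurable_snd
  have h2 : Measurable (fun p : ℝ × Ω => S (j + 1) p.2) := (hS _).comp measurable_snd
  unfold passageTerm
  refine Measurable.ite ?_ (by fun_prop) measurable_const
  exact (measurableSet_le h1 measurable_fst).inter (measurableSet_lt measurable_fst h2)

lemma integrable_passageTerm [IsProbabilityMeasure P] (hS : ∀ i, Measurable (S i)) {q β ρ : ℝ}
    (hq : 0 < q) (hβ : 0 ≤ β) (hρ : 0 ≤ ρ) (j : ℕ) :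
    Integrable (fun p : ℝ × Ω => passageTerm (fun i => S i p.2) q β ρ p.1 j)
      ((volume.restrict (Ioi (0 : ℝ))).prod P) := by
  refine ((integrable_exp_neg_mul_fst P hq).const_mul (ρ ^ (j + 1))).mono'
    (measurable_passageTerm hS q β ρ j).aestronglyMeasurable (ae_of_all _ fun p => ?_)
  rw [Real.norm_of_nonneg (passageTerm_nonneg _ _ _ _ hρ _)]
  exact passageTerm_le _ _ _ hβ hρ _

lemma summable_integral_norm_passageTerm [IsProbabilityMeasure P] (hS : ∀ i, Measurable (S i))
    {q β ρ : ℝ} (hq : 0 < q) (hβ : 0 ≤ β) (hρ : 0 ≤ ρ) (hρ1 : ρ < 1) :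
    Summable fun j => ∫ p : ℝ × Ω, ‖passageTerm (fun i => S i p.2) q β ρ p.1 j‖
      ∂((volume.restrict (Ioi (0 : ℝ))).prod P) := by
  refine Summable.of_nonneg_of_le (fun j => integral_nonneg fun p => norm_nonneg _) (fun j => ?_)
    (((summable_geometric_of_lt_one hρ hρ1).mul_left ρ).mul_right
      (∫ p : ℝ × Ω, Real.exp (-(q * p.1)) ∂((volume.restrict (Ioi (0 : ℝ))).prod P)))
  rw [← integral_const_mul, ← pow_succ']
  refine integral_mono (integrable_passageTerm hS hq hβ hρ j).norm
    ((integrable_exp_neg_mul_fst P hq).const_mul _) fun p => ?_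
  simp only [Real.norm_of_nonneg (passageTerm_nonneg _ _ _ _ hρ _)]
  exact passageTerm_le _ _ _ hβ hρ _

lemma IsRandomWalk.ae_nonneg (hS : IsRandomWalk P 𝒢 S) (k : ℕ) :
    ∀ᵐ ω ∂P, 0 ≤ partialSups (fun i => S i ω) k := by
  filter_upwards [hS.zero] with ω hω
  simpa [hω] using le_partialSups_of_le (fun i => S i ω) (Nat.zero_le k)

lemma IsRandomWalk.ae_norm_exp_le_one (hS : IsRandomWalk P 𝒢 S) {γ : ℝ} (hγ : 0 ≤ γ) (k : ℕ) :
    ∀ᵐ ω ∂P, ‖Real.exp (-(γ * partialSups (fun i => S i ω) k))‖ ≤ 1 := by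
  filter_upwards [hS.ae_nonneg k] with ω hω
  rw [Real.norm_of_nonneg (Real.exp_pos _).le]
  exact Real.exp_le_one_iff.2 (neg_nonpos.2 (mul_nonneg hγ hω))

lemma IsRandomWalk.measurable_exp (hS : IsRandomWalk P 𝒢 S) (γ : ℝ) (k : ℕ) :
    Measurable fun ω => Real.exp (-(γ * partialSups (fun i => S i ω) k)) :=
  ((measurable_partialSups_apply fun i _ => hS.measurable i).const_mul γ).neg.exp

lemma IsRandomWalk.integrable_exp [IsProbabilityMeasure P] (hS : IsRandomWalk P 𝒢 S) {γ : ℝ}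
    (hγ : 0 ≤ γ) (k : ℕ) :
    Integrable (fun ω => Real.exp (-(γ * partialSups (fun i => S i ω) k))) P :=
  (integrable_const (1 : ℝ)).mono' (hS.measurable_exp γ k).aestronglyMeasurable
    (hS.ae_norm_exp_le_one hγ k)

lemma IsRandomWalk.norm_integral_exp_le_one [IsProbabilityMeasure P] (hS : IsRandomWalk P 𝒢 S)
    {γ : ℝ} (hγ : 0 ≤ γ) (k : ℕ) :
    ‖∫ ω, Real.exp (-(γ * partialSups (fun i => S i ω) k)) ∂P‖ ≤ 1 := by
  simpa using norm_integral_le_of_norm_le_const (hS.ae_norm_exp_le_one hγ k)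

lemma IsRandomWalk.summable_norm [IsProbabilityMeasure P] (hS : IsRandomWalk P 𝒢 S) {γ ρ : ℝ}
    (hγ : 0 ≤ γ) (hρ : 0 ≤ ρ) (hρ1 : ρ < 1) :
    Summable fun k => ‖ρ ^ k * ∫ ω, Real.exp (-(γ * partialSups (fun i => S i ω) k)) ∂P‖ := by
  refine Summable.of_nonneg_of_le (fun j => norm_nonneg _) (fun j => ?_)
    (summable_geometric_of_lt_one hρ hρ1)
  rw [norm_mul, Real.norm_of_nonneg (pow_nonneg hρ j)]
  exact mul_le_of_le_one_right (pow_nonneg hρ j) (hS.norm_integral_exp_le_one hγ j)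

lemma IsRandomWalk.integral_passageTerm_prod [IsProbabilityMeasure P] (hS : IsRandomWalk P 𝒢 S)
    {q β ρ : ℝ} (hq : 0 < q) (hβ : 0 ≤ β) (hqβ : q ≠ β) (hρ : 0 ≤ ρ) (j : ℕ) :
    ∫ p : ℝ × Ω, passageTerm (fun i => S i p.2) q β ρ p.1 j
        ∂((volume.restrict (Ioi (0 : ℝ))).prod P) =
      ρ ^ (j + 1) * ∫ ω, Real.exp (-(β * S (j + 1) ω)) *
        (expPrimitive (q - β) (partialSups (fun i => S i ω) (j + 1)) -
          expPrimitive (q - β) (partialSups (fun i => S i ω) j)) ∂P := by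
  rw [integral_prod_symm _ (integrable_passageTerm hS.measurable hq hβ hρ j), ← integral_const_mul]
  refine integral_congr_ae ?_
  filter_upwards [hS.zero] with ω hω
  exact integral_passageTerm hω hqβ ρ j

lemma IsRandomWalk.integrable_record [IsProbabilityMeasure P] (hS : IsRandomWalk P 𝒢 S)
    {q β : ℝ} (hq : 0 < q) (hβ : 0 ≤ β) (hqβ : q ≠ β) (j : ℕ) :
    Integrable (fun ω => Real.exp (-(β * S (j + 1) ω)) *
        (expPrimitive (q - β) (partialSups (fun i => S i ω) (j + 1)) -
          expPrimitive (q - β) (partialSups (fun i => S i ω) j))) P := by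
  refine (integrable_passageTerm (P := P) hS.measurable hq hβ zero_le_one
    j).integral_prod_right.congr ?_
  filter_upwards [hS.zero] with ω hω
  simpa using integral_passageTerm hω hqβ 1 j

lemma IsRandomWalk.integral_exp_sub_div [IsProbabilityMeasure P] (hS : IsRandomWalk P 𝒢 S)
    {q β : ℝ} (hq : 0 < q) (hβ : 0 ≤ β) (hqβ : q ≠ β) (k : ℕ) :
    ((∫ ω, Real.exp (-(β * partialSups (fun i => S i ω) k)) ∂P) -
        ∫ ω, Real.exp (-(q * partialSups (fun i => S i ω) k)) ∂P) / (q - β) =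
      ∑ j ∈ Finset.range k, (∫ ω, Real.exp (-(β * S (j + 1) ω)) *
        (expPrimitive (q - β) (partialSups (fun i => S i ω) (j + 1)) -
          expPrimitive (q - β) (partialSups (fun i => S i ω) j)) ∂P) *
        ∫ ω, Real.exp (-(β * partialSups (fun i => S i ω) (k - (j + 1)))) ∂P := by
  have hF : Measurable (expPrimitive (q - β)) := by unfold expPrimitive; fun_prop
  have hh : Measurable fun y : ℝ => Real.exp (-(β * y)) := by fun_prop
  have hY : ∀ j, Measurable[𝒢 (j + 1)] (fun ω => Real.exp (-(β * S (j + 1) ω)) *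
        (expPrimitive (q - β) (partialSups (fun i => S i ω) (j + 1)) -
          expPrimitive (q - β) (partialSups (fun i => S i ω) j))) := fun j =>
    (hh.comp (hS.adapted (j + 1))).mul
      ((hF.comp (measurable_partialSups_apply fun i hi => hS.measurable_of_le hi)).sub
        (hF.comp (measurable_partialSups_apply fun i hi =>
          hS.measurable_of_le (hi.trans j.le_succ))))
  rw [← integral_sub (hS.integrable_exp hβ k) (hS.integrable_exp hq.le k), ← integral_div]
  calc _ = ∫ ω, ∑ j ∈ Finset.range k, Real.exp (-(β * S (j + 1) ω)) *
        (expPrimitive (q - β) (partialSups (fun i => S i ω) (j + 1)) -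
          expPrimitive (q - β) (partialSups (fun i => S i ω) j)) *
          Real.exp (-(β * restartMax (fun i => S i ω) (j + 1) (k - (j + 1)))) ∂P := by
        refine integral_congr_ae ?_
        filter_upwards [hS.zero] with ω hω
        rw [← exp_mul_partialSups_eq_sum (s := fun i => S i ω) hω β
          (F := expPrimitive (q - β)) (by simp [expPrimitive]) k, exp_mul_expPrimitive]
    _ = _ := by
        rw [integral_finsetSum]
        · exact Finset.sum_congr rfl fun j _ =>
            hS.integral_mul_restartMax (j + 1) (k - (j + 1)) (hY j) hh
        · intro j _
          refine (hS.integrable_record hq hβ hqβ j).mul_bdd (c := 1)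
            (hh.comp (measurable_restartMax hS.measurable _ _)).aestronglyMeasurable
            (ae_of_all _ fun ω => ?_)
          rw [Real.norm_of_nonneg (Real.exp_pos _).le]
          exact Real.exp_le_one_iff.2 (neg_nonpos.2 (mul_nonneg hβ (restartMax_nonneg _ _ _)))

/-- The Pecherskii–Rogozin identity for random walks, killed at a geometric time. -/
lemma IsRandomWalk.pecherskii_rogozin [IsProbabilityMeasure P] (hS : IsRandomWalk P 𝒢 S)
    {q β ρ : ℝ} (hq : 0 < q) (hβ : 0 ≤ β) (hqβ : q ≠ β) (hρ : 0 ≤ ρ) (hρ1 : ρ < 1) :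
    (∫ p : ℝ × Ω, ∑' j, passageTerm (fun i => S i p.2) q β ρ p.1 j
        ∂((volume.restrict (Ioi (0 : ℝ))).prod P)) *
      (∑' k, ρ ^ k * ∫ ω, Real.exp (-(β * partialSups (fun i => S i ω) k)) ∂P) =
      ((∑' k, ρ ^ k * ∫ ω, Real.exp (-(β * partialSups (fun i => S i ω) k)) ∂P) -
        ∑' k, ρ ^ k * ∫ ω, Real.exp (-(q * partialSups (fun i => S i ω) k)) ∂P) / (q - β) := by
  have hsum := summable_integral_norm_passageTerm (P := P) hS.measurable hq hβ hρ hρ1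
  have hsum' : Summable fun j => ‖∫ p : ℝ × Ω, passageTerm (fun i => S i p.2) q β ρ p.1 j
      ∂((volume.restrict (Ioi (0 : ℝ))).prod P)‖ :=
    Summable.of_nonneg_of_le (fun j => norm_nonneg _) (fun j => norm_integral_le_integral_norm _)
      hsum
  rw [← (hasSum_integral_of_summable_integral_norm
    (fun j => integrable_passageTerm hS.measurable hq hβ hρ j) hsum).tsum_eq,
    tsum_mul_tsum_eq_tsum_sum_antidiagonal_of_summable_norm hsum' (hS.summable_norm hβ hρ hρ1),
    ← (hS.summable_norm hβ hρ hρ1).of_norm.tsum_sub (hS.summable_norm hq.le hρ hρ1).of_norm,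
    ← tsum_div_const]
  have hterm : ∀ k, (ρ ^ k * (∫ ω, Real.exp (-(β * partialSups (fun i => S i ω) k)) ∂P) -
      ρ ^ k * ∫ ω, Real.exp (-(q * partialSups (fun i => S i ω) k)) ∂P) / (q - β) =
      ρ ^ k * ∑ j ∈ Finset.range k, (∫ ω, Real.exp (-(β * S (j + 1) ω)) *
        (expPrimitive (q - β) (partialSups (fun i => S i ω) (j + 1)) -
          expPrimitive (q - β) (partialSups (fun i => S i ω) j)) ∂P) *
        ∫ ω, Real.exp (-(β * partialSups (fun i => S i ω) (k - (j + 1)))) ∂P := fun k => by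
    rw [← hS.integral_exp_sub_div hq hβ hqβ k, ← mul_sub, mul_div_assoc]
  rw [(((hS.summable_norm hβ hρ hρ1).of_norm.sub
    (hS.summable_norm hq.le hρ hρ1).of_norm).div_const (q - β)).tsum_eq_zero_add]
  simp_rw [hterm]
  simp only [Finset.range_zero, Finset.sum_empty, mul_zero, zero_add]
  refine tsum_congr fun n => ?_
  rw [Finset.Nat.sum_antidiagonal_eq_sum_range_succ_mk, Finset.mul_sum]
  refine Finset.sum_congr rfl fun j hj => ?_
  have hj' : j ≤ n := Nat.lt_succ_iff.1 (Finset.mem_range.1 hj)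
  rw [hS.integral_passageTerm_prod hq hβ hqβ hρ j, Nat.add_sub_add_right,
    show n + 1 = j + 1 + (n - j) by omega, pow_add ρ (j + 1) (n - j)]
  ring

end RandomWalk

section Path

lemma tendsto_ceil_div_mul {s : ℝ} (hs : 0 ≤ s) :
    Tendsto (fun δ : ℝ => (⌈s / δ⌉₊ : ℝ) * δ) (nhdsWithin 0 (Ioi 0)) (nhdsWithin s (Ici s)) := by
  have hpos : ∀ᶠ δ : ℝ in nhdsWithin 0 (Ioi 0), 0 < δ := self_mem_nhdsWithin
  have hle : ∀ᶠ δ : ℝ in nhdsWithin 0 (Ioi 0), s ≤ (⌈s / δ⌉₊ : ℝ) * δ := by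
    filter_upwards [hpos] with δ hδ
    exact (div_le_iff₀ hδ).1 (Nat.le_ceil _)
  refine tendsto_nhdsWithin_iff.2 ⟨?_, hle⟩
  have hup : Tendsto (fun δ : ℝ => s + δ) (nhdsWithin 0 (Ioi 0)) (nhds s) := by
    have : Tendsto (fun δ : ℝ => s + δ) (nhds 0) (nhds (s + 0)) :=
      (continuous_const.add continuous_id).tendsto 0
    simpa using this.mono_left nhdsWithin_le_nhds
  refine tendsto_of_tendsto_of_tendsto_of_le_of_le' tendsto_const_nhds hup hle ?_
  filter_upwards [hpos] with δ hδ
  have := (Nat.ceil_lt_add_one (div_nonneg hs hδ.le)).le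
  calc (⌈s / δ⌉₊ : ℝ) * δ ≤ (s / δ + 1) * δ := mul_le_mul_of_nonneg_right this hδ.le
    _ = s + δ := by field_simp

/-- A càdlàg function is bounded above on compact intervals. -/
lemma bddAbove_image_Icc_of_cadlag {f : ℝ → ℝ}
    (hr : ∀ t, 0 ≤ t → ContinuousWithinAt f (Ici t) t)
    (hl : ∀ t, 0 < t → ∃ l, Tendsto f (nhdsWithin t (Iio t)) (nhds l)) (t : ℝ) :
    BddAbove (f '' Icc 0 t) := by
  refine isCompact_Icc.induction_on (p := fun s => BddAbove (f '' s)) (by simp)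
    (fun s u hsu h => h.mono (image_mono hsu)) (fun s u hs hu => by
      rw [image_union]; exact hs.union hu) fun x hx => ?_
  have hright : ∀ᶠ y in nhdsWithin x (Ici x), f y ≤ f x + 1 :=
    (hr x hx.1).eventually_le_const (lt_add_one _)
  rcases hx.1.eq_or_lt with h0 | h0
  · subst h0
    refine ⟨{y | f y ≤ f 0 + 1}, nhdsWithin_mono _ (fun y hy => hy.1) hright, f 0 + 1, ?_⟩
    rintro _ ⟨y, hy, rfl⟩
    exact hy
  · obtain ⟨l, hl⟩ := hl x h0
    have hleft : ∀ᶠ y in nhdsWithin x (Iio x), f y ≤ l + 1 :=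
      hl.eventually_le_const (lt_add_one _)
    have hboth : ∀ᶠ y in nhds x, f y ≤ max (f x + 1) (l + 1) := by
      rw [← nhdsLT_sup_nhdsGE, eventually_sup]
      exact ⟨hleft.mono fun y hy => hy.trans (le_max_right _ _),
        hright.mono fun y hy => hy.trans (le_max_left _ _)⟩
    refine ⟨_, mem_nhdsWithin_of_mem_nhds hboth, max (f x + 1) (l + 1), ?_⟩
    rintro _ ⟨y, hy, rfl⟩
    exact hy

lemma tendsto_partialSups_grid {f : ℝ → ℝ}
    (hr : ∀ t, 0 ≤ t → ContinuousWithinAt f (Ici t) t)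
    (hl : ∀ t, 0 < t → ∃ l, Tendsto f (nhdsWithin t (Iio t)) (nhds l)) {t : ℝ} (ht : 0 ≤ t) :
    Tendsto (fun δ : ℝ => partialSups (fun i : ℕ => f (i * δ)) ⌈t / δ⌉₊) (nhdsWithin 0 (Ioi 0))
      (nhds (sSup (f '' Icc 0 t))) := by
  have hbdd := bddAbove_image_Icc_of_cadlag hr hl t
  have hne : (f '' Icc 0 t).Nonempty := ⟨f t, t, ⟨ht, le_rfl⟩, rfl⟩
  have hpos : ∀ᶠ δ : ℝ in nhdsWithin 0 (Ioi 0), 0 < δ := self_mem_nhdsWithin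
  refine tendsto_order.2 ⟨fun a ha => ?_, fun a ha => ?_⟩
  · obtain ⟨_, ⟨s, hs, rfl⟩, has⟩ := exists_lt_of_lt_csSup hne ha
    filter_upwards [hpos, (tendsto_ceil_div_mul hs.1).eventually
      ((hr s hs.1).eventually_const_lt has)] with δ hδ h
    refine h.trans_le (le_partialSups_of_le (fun i : ℕ => f (i * δ)) (Nat.ceil_mono ?_))
    exact div_le_div_of_nonneg_right hs.2 hδ.le
  · have hta : f t < a := (le_csSup hbdd ⟨t, ⟨ht, le_rfl⟩, rfl⟩).trans_lt ha
    obtain ⟨u, hu, hfu⟩ := mem_nhdsGE_iff_exists_Ico_subset.1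
      ((hr t ht).eventually_lt_const hta)
    filter_upwards [hpos, (tendsto_ceil_div_mul ht).eventually
      (mem_nhdsWithin_of_mem_nhds (Iio_mem_nhds hu))] with δ hδ h
    obtain ⟨i, hi, hieq⟩ := exists_partialSups_eq (fun i : ℕ => f (i * δ)) ⌈t / δ⌉₊
    rw [hieq]
    rcases le_total ((i : ℝ) * δ) t with hit | hit
    · exact (le_csSup hbdd ⟨i * δ, ⟨by positivity, hit⟩, rfl⟩).trans_lt ha
    · refine hfu ⟨hit, lt_of_le_of_lt ?_ h⟩
      exact mul_le_mul_of_nonneg_right (by exact_mod_cast hi) hδ.le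

lemma tsum_passageTerm {s : ℕ → ℝ} {x : ℝ} (h0 : s 0 ≤ x) (hne : {k | x < s k}.Nonempty)
    (q β ρ : ℝ) :
    ∑' j, passageTerm s q β ρ x j = ρ ^ sInf {k | x < s k} *
      (Real.exp (-(q * x)) * Real.exp (-(β * (s (sInf {k | x < s k}) - x)))) := by
  have hN : x < s (sInf {k | x < s k}) := Nat.sInf_mem hne
  obtain ⟨n, hn⟩ : ∃ n, sInf {k | x < s k} = n + 1 := by
    refine Nat.exists_eq_succ_of_ne_zero fun h => ?_
    rw [h] at hN
    exact hN.not_ge h0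
  have hbefore : partialSups s n ≤ x := partialSups_le _ _ _ fun i hi =>
    not_lt.1 fun h => Nat.notMem_of_lt_sInf (s := {k | x < s k}) (by omega) h
  rw [hn] at hN ⊢
  rw [tsum_eq_single n, passageTerm, if_pos ⟨hbefore, hN⟩]
  intro j hj
  rw [passageTerm, if_neg]
  rintro ⟨h1, h2⟩
  have hle : n + 1 ≤ j + 1 := hn ▸ Nat.sInf_le h2
  have hlt : n + 1 ≤ j := by omega
  exact ((le_partialSups_of_le s hlt).trans h1).not_gt hN

lemma tendsto_firstGridIndex_mul {f : ℝ → ℝ} (hr : ∀ t, 0 ≤ t → ContinuousWithinAt f (Ici t) t)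
    {x : ℝ} (hx : ∃ t, 0 ≤ t ∧ x < f t) :
    (∀ᶠ δ : ℝ in nhdsWithin 0 (Ioi 0), {k : ℕ | x < f (k * δ)}.Nonempty) ∧
    Tendsto (fun δ : ℝ => (sInf {k : ℕ | x < f (k * δ)} : ℕ) * δ) (nhdsWithin 0 (Ioi 0))
      (nhdsWithin (sInf {t | 0 ≤ t ∧ x < f t}) (Ici (sInf {t | 0 ≤ t ∧ x < f t}))) := by
  set A := {t | 0 ≤ t ∧ x < f t} with hA
  have hbdd : BddBelow A := ⟨0, fun t ht => ht.1⟩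
  have hpos : ∀ᶠ δ : ℝ in nhdsWithin 0 (Ioi 0), 0 < δ := self_mem_nhdsWithin
  have hgrid : ∀ s ∈ A, ∀ a, s < a → ∀ᶠ δ : ℝ in nhdsWithin 0 (Ioi 0),
      0 < δ ∧ x < f (⌈s / δ⌉₊ * δ) ∧ (⌈s / δ⌉₊ : ℝ) * δ < a := fun s hs a ha =>
    hpos.and ((tendsto_ceil_div_mul hs.1).eventually (((hr s hs.1).eventually_const_lt hs.2).and
      (mem_nhdsWithin_of_mem_nhds (Iio_mem_nhds ha))))
  have hne : ∀ᶠ δ : ℝ in nhdsWithin 0 (Ioi 0), {k : ℕ | x < f (k * δ)}.Nonempty := by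
    obtain ⟨s, hs⟩ := hx
    filter_upwards [hgrid s hs (s + 1) (lt_add_one s)] with δ hδ
    exact ⟨_, hδ.2.1⟩
  have hge : ∀ᶠ δ : ℝ in nhdsWithin 0 (Ioi 0),
      sInf A ≤ (sInf {k : ℕ | x < f (k * δ)} : ℕ) * δ := by
    filter_upwards [hne, hpos] with δ hδ hδ0
    exact csInf_le hbdd ⟨by positivity, Nat.sInf_mem hδ⟩
  refine ⟨hne, tendsto_nhdsWithin_iff.2 ⟨tendsto_order.2 ⟨fun a ha => ?_, fun a ha => ?_⟩, hge⟩⟩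
  · exact hge.mono fun δ hδ => ha.trans_le hδ
  · obtain ⟨s, hs, hsa⟩ := exists_lt_of_csInf_lt hx ha
    filter_upwards [hgrid s hs a hsa] with δ hδ
    refine lt_of_le_of_lt ?_ hδ.2.2
    exact mul_le_mul_of_nonneg_right (by exact_mod_cast Nat.sInf_le hδ.2.1) hδ.1.le

lemma tendsto_tsum_passageTerm {X : ℝ → Ω → ℝ} {ω : Ω}
    (hr : ∀ t, 0 ≤ t → ContinuousWithinAt (fun s => X s ω) (Ici t) t) {x : ℝ} (h0 : X 0 ω ≤ x)
    (α β q : ℝ) :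
    Tendsto (fun δ : ℝ => ∑' j, passageTerm (fun i : ℕ => X (i * δ) ω) q β
      (Real.exp (-(α * δ))) x j) (nhdsWithin 0 (Ioi 0))
      (nhds (Real.exp (-(q * x)) * (if hitsAbove X x ω then
          Real.exp (-(α * tauAbove X x ω) - β * (X (tauAbove X x ω) ω - x)) else 0))) := by
  have hpos : ∀ᶠ δ : ℝ in nhdsWithin 0 (Ioi 0), 0 < δ := self_mem_nhdsWithin
  by_cases hx : hitsAbove X x ω
  · obtain ⟨hne, hlim⟩ := tendsto_firstGridIndex_mul hr hx
    have hτ : 0 ≤ tauAbove X x ω := Real.sInf_nonneg fun t ht => ht.1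
    rw [if_pos hx]
    have hXlim := (hr _ hτ).tendsto.comp hlim
    have htlim : Tendsto (fun δ : ℝ => (sInf {k : ℕ | x < X (k * δ) ω} : ℕ) * δ)
      (nhdsWithin 0 (Ioi 0)) (nhds (tauAbove X x ω)) := hlim.mono_right nhdsWithin_le_nhds
    refine ((((htlim.const_mul α).neg.sub ((hXlim.sub_const x).const_mul β)).rexp).const_mul
      (Real.exp (-(q * x)))).congr' ?_
    filter_upwards [hne] with δ hδ
    rw [tsum_passageTerm (by simpa using h0) hδ, ← Real.exp_nat_mul, sub_eq_add_neg, Real.exp_add]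
    simp only [Function.comp_apply]
    generalize sInf {k : ℕ | x < X (k * δ) ω} = N
    ring_nf
  · rw [if_neg hx, mul_zero]
    refine tendsto_const_nhds.congr' ?_
    filter_upwards [hpos] with δ hδ
    have hzero : ∀ j, passageTerm (fun i : ℕ => X (i * δ) ω) q β (Real.exp (-(α * δ))) x j = 0 :=
      fun j => if_neg fun h => hx ⟨_, by positivity, h.2⟩
    simp [hzero]

end Path

section Levy

variable [m0 : MeasurableSpace Ω] {P : Measure Ω} {ℱ : Filtration ℝ m0} {X : ℝ → Ω → ℝ}

/-- The restriction of a continuous-time filtration to the grid of mesh `δ`. -/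
def gridFiltration (ℱ : Filtration ℝ m0) {δ : ℝ} (hδ : 0 ≤ δ) : Filtration ℕ m0 where
  seq j := ℱ (j * δ)
  mono' _ _ h := ℱ.mono (mul_le_mul_of_nonneg_right (by exact_mod_cast h) hδ)
  le' _ := ℱ.le _

lemma IsLevy.isRandomWalk (hX : IsLevy P ℱ X) {δ : ℝ} (hδ : 0 ≤ δ) :
    IsRandomWalk P (gridFiltration ℱ hδ) (fun i ω => X (i * δ) ω) where
  adapted j := (hX.adapted _ (by positivity)).measurable
  indep j := hX.indepIncrements _ _ (by positivity)
    (mul_le_mul_of_nonneg_right (by simp) hδ)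
  ident j := by
    rw [hX.stationary _ _ (by positivity) (mul_le_mul_of_nonneg_right (by simp) hδ)]
    have h := hX.stationary ((0 : ℕ) * δ) ((1 : ℕ) * δ) (by positivity)
      (mul_le_mul_of_nonneg_right (by simp) hδ)
    rw [h]
    congr 2
    push_cast
    ring
  zero := by simpa using hX.zero

lemma tendsto_one_div_add_nhdsWithin :
    Tendsto (fun n : ℕ => 1 / ((n : ℝ) + 1)) atTop (nhdsWithin 0 (Ioi 0)) :=
  tendsto_nhdsWithin_iff.2 ⟨tendsto_one_div_add_atTop_nhds_zero_nat,
    Eventually.of_forall fun n => by simp only [mem_Ioi]; positivity⟩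

lemma measurable_comp_ceil_div (c : ℕ → ℝ) (δ : ℝ) : Measurable fun t : ℝ => c ⌈t / δ⌉₊ :=
  (measurable_from_nat (f := c)).comp (Nat.measurable_ceil.comp (measurable_id.div_const δ))

lemma integrableOn_mul_exp_neg_mul {α : ℝ} (hα : 0 < α) :
    IntegrableOn (fun t : ℝ => α * Real.exp (-(α * t))) (Ioi 0) := by
  have h : Integrable (fun t : ℝ => α * Real.exp (-(α * t))) (volume.restrict (Ioi 0)) := by
    simpa only [neg_mul] using (exp_neg_integrableOn_Ioi 0 hα).integrable.const_mul α
  exact h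

lemma integral_exp_ceil_eq_tsum {α δ : ℝ} (hα : 0 < α) (hδ : 0 < δ) {c : ℕ → ℝ}
    (hc : ∀ k, ‖c k‖ ≤ 1) :
    ∫ t in Ioi (0 : ℝ), α * Real.exp (-(α * t)) * c ⌈t / δ⌉₊ =
      ∑' k : ℕ, (1 - Real.exp (-(α * δ))) * (Real.exp (-(α * δ)) ^ k * c (k + 1)) := by
  let s : ℕ → Set ℝ := fun k => Ioc (k * δ) ((k + 1 : ℕ) * δ)
  have hmem : ∀ {k : ℕ} {t : ℝ}, t ∈ s k ↔ ⌈t / δ⌉₊ = k + 1 := fun {k t} => by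
    rw [Nat.ceil_eq_iff k.succ_ne_zero, lt_div_iff₀ hδ, div_le_iff₀ hδ]
    rfl
  have hU : ⋃ k, s k = Ioi 0 := by
    ext t
    simp only [mem_iUnion, hmem, mem_Ioi]
    constructor
    · rintro ⟨k, hk⟩
      have : 0 < ⌈t / δ⌉₊ := by omega
      exact (div_pos_iff_of_pos_right hδ).1 (Nat.ceil_pos.1 this)
    · intro ht
      have : 0 < ⌈t / δ⌉₊ := Nat.ceil_pos.2 (div_pos ht hδ)
      exact ⟨⌈t / δ⌉₊ - 1, by omega⟩
  have hdisj : Pairwise (Function.onFun Disjoint s) := fun i j hij =>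
    disjoint_left.2 fun t hi hj => hij (by
      have := hmem.1 hi; have := hmem.1 hj; omega)
  have h_int : IntegrableOn (fun t : ℝ => α * Real.exp (-(α * t)) * c ⌈t / δ⌉₊) (⋃ k, s k) := by
    rw [hU]
    exact (integrableOn_mul_exp_neg_mul hα).integrable.mul_bdd (c := 1)
      (measurable_comp_ceil_div c δ).aestronglyMeasurable (ae_of_all _ fun t => hc _)
  have hsum := hasSum_integral_iUnion (fun k => measurableSet_Ioc) hdisj h_int
  rw [hU] at hsum
  rw [← hsum.tsum_eq]
  refine tsum_congr fun k => ?_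
  have hk : (k : ℝ) * δ ≤ ((k + 1 : ℕ) : ℝ) * δ := mul_le_mul_of_nonneg_right (by simp) hδ.le
  rw [setIntegral_congr_fun (g := fun t => α * c (k + 1) * Real.exp (-(α * t))) measurableSet_Ioc
    fun t ht => by simp only [hmem.1 ht]; ring, integral_const_mul,
    ← intervalIntegral.integral_of_le hk, intervalIntegral_exp_neg_mul hα.ne', expPrimitive,
    expPrimitive, ← Real.exp_nat_mul,
    show -(α * (((k + 1 : ℕ) : ℝ) * δ)) = k * -(α * δ) + -(α * δ) by push_cast; ring,
    show -(α * (k * δ)) = k * -(α * δ) by ring, Real.exp_add]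
  field_simp
  ring

lemma IsLevy.measurable (hX : IsLevy P ℱ X) {t : ℝ} (ht : 0 ≤ t) : Measurable (X t) :=
  ((hX.adapted t ht).mono (ℱ.le t)).measurable

lemma IsLevy.runSup_nonneg (hX : IsLevy P ℱ X) {t : ℝ} (ht : 0 ≤ t) :
    ∀ᵐ ω ∂P, 0 ≤ runSup X t ω := by
  filter_upwards [hX.zero] with ω hω
  rw [← hω]
  exact le_csSup (bddAbove_image_Icc_of_cadlag (hX.rightCont ω) (hX.leftLim ω) t)
    ⟨0, ⟨le_rfl, ht⟩, rfl⟩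

lemma IsLevy.tendsto_exp_partialSups (hX : IsLevy P ℱ X) (γ : ℝ) {t : ℝ} (ht : 0 ≤ t) (ω : Ω) :
    Tendsto (fun δ : ℝ => Real.exp (-(γ * partialSups (fun i : ℕ => X (i * δ) ω) ⌈t / δ⌉₊)))
      (nhdsWithin 0 (Ioi 0)) (nhds (Real.exp (-(γ * runSup X t ω)))) :=
  (((tendsto_partialSups_grid (hX.rightCont ω) (hX.leftLim ω) ht).const_mul γ).neg).rexp

lemma IsLevy.tendsto_integral_exp_partialSups (hX : IsLevy P ℱ X) {γ : ℝ} (hγ : 0 ≤ γ) {t : ℝ}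
    (ht : 0 ≤ t) :
    Tendsto (fun δ : ℝ => ∫ ω, Real.exp (-(γ * partialSups (fun i : ℕ => X (i * δ) ω) ⌈t / δ⌉₊)) ∂P)
      (nhdsWithin 0 (Ioi 0)) (nhds (∫ ω, Real.exp (-(γ * runSup X t ω)) ∂P)) := by
  have := hX.isProb
  have hpos : ∀ᶠ δ : ℝ in nhdsWithin 0 (Ioi 0), 0 < δ := self_mem_nhdsWithin
  refine tendsto_integral_filter_of_dominated_convergence (fun _ => 1) ?_ ?_
    (integrable_const _) (ae_of_all _ fun ω => hX.tendsto_exp_partialSups γ ht ω)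
  · filter_upwards [hpos] with δ hδ
    exact ((hX.isRandomWalk hδ.le).measurable_exp γ _).aestronglyMeasurable
  · filter_upwards [hpos] with δ hδ
    exact (hX.isRandomWalk hδ.le).ae_norm_exp_le_one hγ _

lemma IsLevy.integrable_exp_runSup (hX : IsLevy P ℱ X) {γ : ℝ} (hγ : 0 ≤ γ) {t : ℝ}
    (ht : 0 ≤ t) : Integrable (fun ω => Real.exp (-(γ * runSup X t ω))) P := by
  have := hX.isProb
  refine (integrable_const (1 : ℝ)).mono' (aestronglyMeasurable_of_tendsto_ae atTop
    (f := fun (n : ℕ) ω => Real.exp (-(γ * partialSups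
      (fun i : ℕ => X (i * (1 / ((n : ℝ) + 1))) ω) ⌈t / (1 / ((n : ℝ) + 1))⌉₊)))
    (fun n => ((hX.isRandomWalk (δ := 1 / ((n : ℝ) + 1)) (by positivity)).measurable_exp
      γ _).aestronglyMeasurable) (ae_of_all _ fun ω => ?_)) ?_
  · exact (hX.tendsto_exp_partialSups γ ht ω).comp tendsto_one_div_add_nhdsWithin
  · filter_upwards [hX.runSup_nonneg ht] with ω hω
    rw [Real.norm_of_nonneg (Real.exp_pos _).le]
    exact Real.exp_le_one_iff.2 (neg_nonpos.2 (mul_nonneg hγ hω))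

/-- The expected exponential of the running maximum of the process sampled on the grid of mesh `δ`,
killed at a geometric time, converges to its continuous-time counterpart. -/
lemma IsLevy.tendsto_expSupLT (hX : IsLevy P ℱ X) {α γ : ℝ} (hα : 0 < α) (hγ : 0 ≤ γ) :
    Tendsto (fun δ : ℝ => (1 - Real.exp (-(α * δ))) * ∑' k : ℕ, Real.exp (-(α * δ)) ^ k *
        ∫ ω, Real.exp (-(γ * partialSups (fun i : ℕ => X (i * δ) ω) k)) ∂P)
      (nhdsWithin 0 (Ioi 0)) (nhds (expSupLT P X α γ)) := by
  have := hX.isProb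
  have hpos : ∀ᶠ δ : ℝ in nhdsWithin 0 (Ioi 0), 0 < δ := self_mem_nhdsWithin
  let c : ℝ → ℕ → ℝ := fun δ k =>
    ∫ ω, Real.exp (-(γ * partialSups (fun i : ℕ => X (i * δ) ω) k)) ∂P
  have hc : ∀ {δ : ℝ}, 0 < δ → ∀ k, ‖c δ k‖ ≤ 1 := fun hδ k =>
    (hX.isRandomWalk hδ.le).norm_integral_exp_le_one hγ k
  have hmain : Tendsto (fun δ : ℝ => ∫ t in Ioi (0 : ℝ), α * Real.exp (-(α * t)) * c δ ⌈t / δ⌉₊)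
      (nhdsWithin 0 (Ioi 0)) (nhds (expSupLT P X α γ)) := by
    refine tendsto_integral_filter_of_dominated_convergence _ (Eventually.of_forall fun δ => ?_)
      ?_ (integrableOn_mul_exp_neg_mul hα) ?_
    · exact ((by fun_prop : Measurable fun t : ℝ => α * Real.exp (-(α * t))).mul
        (measurable_comp_ceil_div (c δ) δ)).aestronglyMeasurable
    · filter_upwards [hpos] with δ hδ
      refine ae_of_all _ fun t => ?_
      rw [norm_mul, Real.norm_of_nonneg (by positivity : 0 ≤ α * Real.exp (-(α * t)))]
      exact mul_le_of_le_one_right (by positivity) (hc hδ _)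
    · filter_upwards [ae_restrict_mem measurableSet_Ioi] with t ht
      exact (hX.tendsto_integral_exp_partialSups hγ (le_of_lt ht)).const_mul _
  have hρ : Tendsto (fun δ : ℝ => Real.exp (-(α * δ))) (nhdsWithin 0 (Ioi 0)) (nhds 1) := by
    have : Tendsto (fun δ : ℝ => Real.exp (-(α * δ))) (nhds 0) (nhds (Real.exp (-(α * 0)))) :=
      (by fun_prop : Continuous fun δ : ℝ => Real.exp (-(α * δ))).tendsto 0
    simpa using this.mono_left nhdsWithin_le_nhds
  have hc0 : ∀ δ, c δ 0 = ∫ ω, Real.exp (-(γ * X 0 ω)) ∂P := fun δ => by simp [c]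
  have hlim := ((hρ.const_sub 1).mul_const (∫ ω, Real.exp (-(γ * X 0 ω)) ∂P)).add (hρ.mul hmain)
  simp only [sub_self, zero_mul, one_mul, zero_add] at hlim
  refine hlim.congr' ?_
  filter_upwards [hpos] with δ hδ
  have hρ1 : Real.exp (-(α * δ)) < 1 := Real.exp_lt_one_iff.2 (by nlinarith)
  have hs : Summable fun k => Real.exp (-(α * δ)) ^ k * c δ k :=
    ((hX.isRandomWalk hδ.le).summable_norm hγ (Real.exp_pos _).le hρ1).of_norm
  rw [integral_exp_ceil_eq_tsum hα hδ (hc hδ), tsum_mul_left]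
  change _ = (1 - Real.exp (-(α * δ))) * ∑' k : ℕ, Real.exp (-(α * δ)) ^ k * c δ k
  rw [hs.tsum_eq_zero_add, hc0, pow_zero, one_mul, mul_add]
  congr 1
  rw [mul_left_comm, ← tsum_mul_left]
  congr 1
  refine tsum_congr fun k => ?_
  rw [pow_succ']
  ring

lemma IsLevy.expSupLT_pos (hX : IsLevy P ℱ X) {α γ : ℝ} (hα : 0 < α) (hγ : 0 ≤ γ) :
    0 < expSupLT P X α γ := by
  have := hX.isProb
  have hE : ∀ t : ℝ, 0 ≤ t → 0 < ∫ ω, Real.exp (-(γ * runSup X t ω)) ∂P := fun t ht =>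
    integral_exp_pos (hX.integrable_exp_runSup hγ ht)
  have hE1 : ∀ t : ℝ, 0 ≤ t → ‖∫ ω, Real.exp (-(γ * runSup X t ω)) ∂P‖ ≤ 1 := fun t ht => by
    have := norm_integral_le_of_norm_le_const (μ := P) (C := 1)
      (f := fun ω => Real.exp (-(γ * runSup X t ω))) (by
        filter_upwards [hX.runSup_nonneg ht] with ω hω
        rw [Real.norm_of_nonneg (Real.exp_pos _).le]
        exact Real.exp_le_one_iff.2 (neg_nonpos.2 (mul_nonneg hγ hω)))
    simpa using this
  have hmeas : AEStronglyMeasurable (fun t => ∫ ω, Real.exp (-(γ * runSup X t ω)) ∂P)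
      (volume.restrict (Ioi (0 : ℝ))) := by
    refine aestronglyMeasurable_of_tendsto_ae (nhdsWithin (0 : ℝ) (Ioi 0))
      (fun δ => (measurable_comp_ceil_div (fun k => ∫ ω, Real.exp (-(γ * partialSups
        (fun i : ℕ => X (i * δ) ω) k)) ∂P) δ).aestronglyMeasurable) ?_
    filter_upwards [ae_restrict_mem measurableSet_Ioi] with t ht
    exact hX.tendsto_integral_exp_partialSups hγ (le_of_lt ht)
  have h_int : IntegrableOn (fun t => α * Real.exp (-(α * t)) *
      ∫ ω, Real.exp (-(γ * runSup X t ω)) ∂P) (Ioi 0) :=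
    (integrableOn_mul_exp_neg_mul hα).integrable.mul_bdd (c := 1) hmeas (by
      filter_upwards [ae_restrict_mem measurableSet_Ioi] with t ht
      exact hE1 t (le_of_lt ht))
  have hpos : ∀ t ∈ Ioi (0 : ℝ), 0 < α * Real.exp (-(α * t)) *
      ∫ ω, Real.exp (-(γ * runSup X t ω)) ∂P := fun t ht =>
    mul_pos (by positivity) (hE t (le_of_lt ht))
  refine (setIntegral_pos_iff_support_of_nonneg_ae ?_ h_int).2 ?_
  · filter_upwards [ae_restrict_mem measurableSet_Ioi] with t ht
    exact (hpos t ht).le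
  · have hsub : Ioi (0 : ℝ) ⊆ Function.support (fun t => α * Real.exp (-(α * t)) *
        ∫ ω, Real.exp (-(γ * runSup X t ω)) ∂P) := fun t ht => (hpos t ht).ne'
    rw [inter_eq_self_of_subset_right hsub]
    simp

lemma IsLevy.tendsto_integral_tsum_passageTerm (hX : IsLevy P ℱ X) {α β q : ℝ} (hα : 0 < α)
    (hβ : 0 ≤ β) (hq : 0 < q) :
    Tendsto (fun δ : ℝ => ∫ p : ℝ × Ω, ∑' j, passageTerm (fun i : ℕ => X (i * δ) p.2) q β
        (Real.exp (-(α * δ))) p.1 j ∂((volume.restrict (Ioi (0 : ℝ))).prod P))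
      (nhdsWithin 0 (Ioi 0))
      (nhds (∫ x in Ioi (0 : ℝ), Real.exp (-(q * x)) *
        (∫ ω, (if hitsAbove X x ω then
          Real.exp (-(α * tauAbove X x ω) - β * (X (tauAbove X x ω) ω - x)) else 0) ∂P))) := by
  have := hX.isProb
  let ν := (volume.restrict (Ioi (0 : ℝ))).prod P
  have hpos : ∀ᶠ δ : ℝ in nhdsWithin 0 (Ioi 0), 0 < δ := self_mem_nhdsWithin
  have hx : ∀ᵐ p ∂ν, 0 < p.1 :=
    Measure.quasiMeasurePreserving_fst.ae (ae_restrict_mem measurableSet_Ioi)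
  have hω : ∀ᵐ p ∂ν, X 0 p.2 = 0 := Measure.quasiMeasurePreserving_snd.ae hX.zero
  have hlim : ∀ᵐ p ∂ν, Tendsto (fun δ : ℝ => ∑' j, passageTerm (fun i : ℕ => X (i * δ) p.2) q β
      (Real.exp (-(α * δ))) p.1 j) (nhdsWithin 0 (Ioi 0))
      (nhds (Real.exp (-(q * p.1)) * (if hitsAbove X p.1 p.2 then Real.exp
        (-(α * tauAbove X p.1 p.2) - β * (X (tauAbove X p.1 p.2) p.2 - p.1)) else 0))) := by
    filter_upwards [hx, hω] with p hp hp0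
    exact tendsto_tsum_passageTerm (hX.rightCont p.2) (hp0.trans_le hp.le) α β q
  have hmeas : ∀ δ : ℝ, 0 < δ → AEStronglyMeasurable (fun p : ℝ × Ω =>
      ∑' j, passageTerm (fun i : ℕ => X (i * δ) p.2) q β (Real.exp (-(α * δ))) p.1 j) ν :=
    fun δ hδ => (Measurable.tsum (L := SummationFilter.unconditional ℕ) fun j => measurable_passageTerm
      (S := fun (i : ℕ) ω => X (i * δ) ω) (fun i => hX.measurable (by positivity)) q β
      (Real.exp (-(α * δ))) j).aestronglyMeasurable
  have hbound : ∀ᵐ p ∂ν, ∀ δ : ℝ, 0 < δ →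
      ‖∑' j, passageTerm (fun i : ℕ => X (i * δ) p.2) q β (Real.exp (-(α * δ))) p.1 j‖ ≤
        Real.exp (-(q * p.1)) := by
    filter_upwards [hx, hω] with p hp hp0 δ hδ
    have hρ1 : Real.exp (-(α * δ)) ≤ 1 := Real.exp_le_one_iff.2 (by nlinarith)
    by_cases hne : {k : ℕ | p.1 < X (k * δ) p.2}.Nonempty
    · have hN := Nat.sInf_mem hne
      rw [tsum_passageTerm (s := fun i : ℕ => X (i * δ) p.2) (by simp [hp0, hp.le]) hne,
        Real.norm_of_nonneg (by positivity)]
      refine (mul_le_of_le_one_left (by positivity) (pow_le_one₀ (Real.exp_pos _).le hρ1)).trans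
        (mul_le_of_le_one_right (by positivity) (Real.exp_le_one_iff.2 ?_))
      exact neg_nonpos.2 (mul_nonneg hβ (sub_nonneg.2 (le_of_lt hN)))
    · have hzero : ∀ j, passageTerm (fun i : ℕ => X (i * δ) p.2) q β (Real.exp (-(α * δ))) p.1 j
          = 0 := fun j => if_neg fun h => hne ⟨_, h.2⟩
      simp only [hzero, tsum_zero, norm_zero]
      positivity
  have h_int : Integrable (fun p : ℝ × Ω => Real.exp (-(q * p.1)) * (if hitsAbove X p.1 p.2 then
      Real.exp (-(α * tauAbove X p.1 p.2) - β * (X (tauAbove X p.1 p.2) p.2 - p.1)) else 0)) ν := by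
    refine (integrable_exp_neg_mul_fst P hq).mono' (aestronglyMeasurable_of_tendsto_ae atTop
      (fun n : ℕ => hmeas (1 / ((n : ℝ) + 1)) (by positivity)) ?_) ?_
    · filter_upwards [hlim] with p hp
      exact hp.comp tendsto_one_div_add_nhdsWithin
    · filter_upwards [hlim, hbound] with p hp hpb
      exact le_of_tendsto hp.norm (hpos.mono hpb)
  simp_rw [← integral_const_mul]
  rw [← integral_prod _ h_int]
  exact tendsto_integral_filter_of_dominated_convergence _ (hpos.mono hmeas)
    (hpos.mono fun δ hδ => hbound.mono fun p hp => hp δ hδ)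
    (integrable_exp_neg_mul_fst P hq) hlim

end Levy

theorem stmt3 [m0 : MeasurableSpace Ω] (P : Measure Ω) (ℱ : Filtration ℝ m0)
    (X : ℝ → Ω → ℝ) (hX : IsLevy P ℱ X)
    (α β q : ℝ) (hα : 0 < α) (hβ : 0 ≤ β) (hq : 0 < q) (hqβ : q ≠ β) :
    (∫ x in Set.Ioi (0 : ℝ), Real.exp (-(q * x)) *
        (∫ ω, (if hitsAbove X x ω then
          Real.exp (-(α * tauAbove X x ω) - β * (X (tauAbove X x ω) ω - x)) else 0) ∂P)) =
      (expSupLT P X α β - expSupLT P X α q) / ((q - β) * expSupLT P X α β) := by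
  have := hX.isProb
  have hrel : (∫ x in Set.Ioi (0 : ℝ), Real.exp (-(q * x)) *
        (∫ ω, (if hitsAbove X x ω then
          Real.exp (-(α * tauAbove X x ω) - β * (X (tauAbove X x ω) ω - x)) else 0) ∂P)) *
      expSupLT P X α β = (expSupLT P X α β - expSupLT P X α q) / (q - β) := by
    refine tendsto_nhds_unique
      ((hX.tendsto_integral_tsum_passageTerm hα hβ hq).mul (hX.tendsto_expSupLT hα hβ))
      ((((hX.tendsto_expSupLT hα hβ).sub (hX.tendsto_expSupLT hα hq.le)).div_const
        (q - β)).congr' ?_)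
    filter_upwards [self_mem_nhdsWithin] with δ hδ
    have hδ : 0 < δ := hδ
    have hρ1 : Real.exp (-(α * δ)) < 1 := Real.exp_lt_one_iff.2 (by nlinarith)
    rw [mul_left_comm, (hX.isRandomWalk hδ.le).pecherskii_rogozin hq hβ hqβ
      (Real.exp_pos _).le hρ1]
    ring
  rw [← div_div, ← hrel, mul_div_cancel_right₀ _ (hX.expSupLT_pos hα hβ).ne']

end AKLevy
end
end

section
/- (Mordecki's value function formula.) Let K > 0 and assume either r > 0, or r = 0 and ℙ(lim_{t → ∞} X_t = ∞) = 1. Put m = E[e^{X̲_{e_r}}], where for r > 0 this means ∫_0^∞ r e^{−r t} E[e^{X̲_t}] dt and for r = 0 it means E[e^{X̲_∞}] with X̲_∞ = inf_{t ≥ 0} X_t. Then for every x ∈ ℝ, sup_{τ} E[e^{−r τ} (K − e^{x + X_τ})^+ 1_{{τ < ∞}}] = E[(K m − e^{x + X̲_{e_r}})^+] / m, where the supremum is taken over all stopping times τ : Ω → [0, ∞] with respect to (F_t)_{t ≥ 0}. -/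
open MeasureTheory ProbabilityTheory Set Filter
open scoped ENNReal NNReal Classical

noncomputable section

namespace AKLevy

variable {Ω : Type*}

/-- The path `t ↦ e^{X_t}` as an extended nonnegative real. -/
def expPath (X : ℝ → Ω → ℝ) (t : ℝ≥0) (ω : Ω) : ℝ≥0∞ := ENNReal.ofReal (Real.exp (X t ω))

/-- `inf_{s ≤ u ≤ T} e^{X_u}` for `s, T ∈ [0, ∞]`, over finite times `u`. -/
def expInf (X : ℝ → Ω → ℝ) (s T : ℝ≥0∞) (ω : Ω) : ℝ≥0∞ :=
  ⨅ (u : ℝ≥0) (_ : s ≤ u) (_ : (u : ℝ≥0∞) ≤ T), expPath X u ω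

/-- Approximation of a time from the right on the grid of mesh `1 / (n + 1)`. -/
def ceilTime (n : ℕ) (t : ℝ≥0) : ℝ≥0 := (⌈t * (n + 1)⌉₊ : ℝ≥0) / (n + 1)

lemma le_ceilTime (n : ℕ) (t : ℝ≥0) : t ≤ ceilTime n t := by
  rw [ceilTime, le_div_iff₀ (by positivity)]
  exact Nat.le_ceil _

lemma ceilTime_le (n : ℕ) (t : ℝ≥0) : ceilTime n t ≤ t + 1 / (n + 1) := by
  rw [ceilTime, div_le_iff₀ (by positivity), add_mul, one_div, inv_mul_cancel₀ (by positivity)]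
  exact (Nat.ceil_lt_add_one (by positivity)).le

lemma tendsto_ceilTime (t : ℝ≥0) : Tendsto (fun n => ceilTime n t) atTop (nhds t) := by
  refine tendsto_of_tendsto_of_tendsto_of_le_of_le (h := fun n : ℕ => t + 1 / ((n : ℝ≥0) + 1))
    tendsto_const_nhds ?_ (fun n => le_ceilTime n t) (fun n => ceilTime_le n t)
  simpa using tendsto_const_nhds.add (tendsto_one_div_add_atTop_nhds_zero_nat (𝕜 := ℝ≥0))

section ExpPath

variable {X : ℝ → Ω → ℝ}

lemma expPath_ne_zero (t : ℝ≥0) (ω : Ω) : expPath X t ω ≠ 0 := by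
  simp [expPath, Real.exp_pos]

lemma expPath_ne_top (t : ℝ≥0) (ω : Ω) : expPath X t ω ≠ ∞ := ENNReal.ofReal_ne_top

lemma expPath_div (s t : ℝ≥0) (ω : Ω) :
    expPath X t ω / expPath X s ω = ENNReal.ofReal (Real.exp (X t ω - X s ω)) := by
  rw [expPath, expPath, ← ENNReal.ofReal_div_of_pos (Real.exp_pos _), ← Real.exp_sub]

lemma expPath_mul_div (s t : ℝ≥0) (ω : Ω) :
    expPath X s ω * (expPath X t ω / expPath X s ω) = expPath X t ω :=
  ENNReal.mul_div_cancel (expPath_ne_zero s ω) (expPath_ne_top s ω)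

lemma expInf_le {s T : ℝ≥0∞} {ω : Ω} {u : ℝ≥0} (hs : s ≤ u) (hT : (u : ℝ≥0∞) ≤ T) :
    expInf X s T ω ≤ expPath X u ω :=
  iInf_le_of_le u (iInf_le_of_le hs (iInf_le _ hT))

lemma le_expInf {s T a : ℝ≥0∞} {ω : Ω}
    (h : ∀ u : ℝ≥0, s ≤ u → (u : ℝ≥0∞) ≤ T → a ≤ expPath X u ω) : a ≤ expInf X s T ω :=
  le_iInf fun u => le_iInf fun hs => le_iInf fun hT => h u hs hT

lemma expInf_mono {s s' T : ℝ≥0∞} (h : s ≤ s') (ω : Ω) : expInf X s T ω ≤ expInf X s' T ω :=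
  le_expInf fun _ hs hT => expInf_le (h.trans hs) hT

lemma expInf_eq_top {s T : ℝ≥0∞} {ω : Ω} (h : T < s) : expInf X s T ω = ∞ :=
  top_le_iff.1 (le_expInf fun _ hs hT => absurd (hs.trans hT) (not_le.2 h))

lemma expInf_top_left {T : ℝ≥0∞} {ω : Ω} : expInf X ∞ T ω = ∞ :=
  top_le_iff.1 (le_expInf fun _ hs _ => absurd hs (by simp))

variable [m0 : MeasurableSpace Ω] {P : Measure Ω} {ℱ : Filtration ℝ m0}

lemma IsLevy.tendsto_expPath (hX : IsLevy P ℱ X) {ι : Type*} {l : Filter ι} {v : ι → ℝ≥0}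
    {u : ℝ≥0} (hv : Tendsto v l (nhds u)) (huv : ∀ i, u ≤ v i) (ω : Ω) :
    Tendsto (fun i => expPath X (v i) ω) l (nhds (expPath X u ω)) := by
  have h1 : Tendsto (fun i => ((v i : ℝ≥0) : ℝ)) l (nhdsWithin (u : ℝ) (Ici (u : ℝ))) :=
    tendsto_nhdsWithin_iff.2 ⟨(NNReal.tendsto_coe.2 hv), Eventually.of_forall fun i => huv i⟩
  have h2 := (hX.rightCont ω u u.2).tendsto.comp h1
  exact ENNReal.tendsto_ofReal ((Real.continuous_exp.tendsto _).comp h2)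

lemma IsLevy.measurable_expPath (hX : IsLevy P ℱ X) (t : ℝ≥0) :
    Measurable[ℱ t] (expPath X t) :=
  (ENNReal.measurable_ofReal.comp Real.measurable_exp).comp (hX.adapted t t.2).measurable

lemma IsLevy.measurable_expPath' (hX : IsLevy P ℱ X) (t : ℝ≥0) : Measurable (expPath X t) :=
  (hX.measurable_expPath t).mono (ℱ.le _) le_rfl

lemma IsLevy.measurable_expPath_uncurry (hX : IsLevy P ℱ X) :
    Measurable fun p : ℝ≥0 × Ω => expPath X p.1 p.2 := by
  refine measurable_of_tendsto_metrizable (f := fun n (p : ℝ≥0 × Ω) =>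
    expPath X (ceilTime n p.1) p.2) (fun n => ?_) ?_
  · have h : Measurable fun p : ℕ × Ω => expPath X ((p.1 : ℝ≥0) / (n + 1)) p.2 :=
      measurable_from_prod_countable_right fun k =>
        hX.measurable_expPath' ((k : ℝ≥0) / (n + 1))
    have h2 : Measurable fun p : ℝ≥0 × Ω => (⌈p.1 * (n + 1)⌉₊, p.2) :=
      (Nat.measurable_ceil.comp (measurable_fst.mul_const _)).prodMk measurable_snd
    simpa only [ceilTime, Function.comp_def] using h.comp h2
  · exact tendsto_pi_nhds.2 fun p =>
      hX.tendsto_expPath (tendsto_ceilTime p.1) (fun n => le_ceilTime n p.1) p.2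

lemma IsLevy.expInf_eq (hX : IsLevy P ℱ X) {s T : ℝ≥0∞} (hs : s ≠ ∞) (hsT : s ≤ T) (ω : Ω) :
    expInf X s T ω = ⨅ p : ℕ × ℕ,
      expPath X (min (s + (((p.1 : ℝ≥0) / (p.2 + 1) : ℝ≥0) : ℝ≥0∞)) T).toNNReal ω := by
  refine le_antisymm (le_iInf fun p => expInf_le ?_ ?_) (le_expInf fun u hsu huT => ?_)
  · rw [ENNReal.coe_toNNReal (ne_top_of_le_ne_top (by finiteness) (min_le_left _ _))]
    exact le_min le_self_add hsT
  · rw [ENNReal.coe_toNNReal (ne_top_of_le_ne_top (by finiteness) (min_le_left _ _))]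
    exact min_le_right _ _
  · lift s to ℝ≥0 using hs
    have hsu' : s ≤ u := by exact_mod_cast hsu
    have hlim : Tendsto (fun n => (min ((s : ℝ≥0∞) + (ceilTime n (u - s) : ℝ≥0)) T).toNNReal)
        atTop (nhds u) := by
      have h1 : Tendsto (fun n => ((s : ℝ≥0∞) + (ceilTime n (u - s) : ℝ≥0))) atTop
          (nhds ((s : ℝ≥0∞) + (u - s : ℝ≥0))) :=
        tendsto_const_nhds.add (ENNReal.tendsto_coe.2 (tendsto_ceilTime _))
      have h2 := h1.min (tendsto_const_nhds (x := T))
      have h3 : min ((s : ℝ≥0∞) + (u - s : ℝ≥0)) T = u := by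
        rw [← ENNReal.coe_add, add_tsub_cancel_of_le hsu', min_eq_left huT]
      rw [h3] at h2
      exact (ENNReal.tendsto_toNNReal (by simp)).comp h2
    refine ge_of_tendsto (hX.tendsto_expPath hlim (fun n => ?_) ω)
      (Eventually.of_forall fun n => ?_)
    · rw [← ENNReal.coe_le_coe,
        ENNReal.coe_toNNReal (ne_top_of_le_ne_top (by finiteness) (min_le_left _ _))]
      refine le_min ?_ huT
      rw [← ENNReal.coe_add, ENNReal.coe_le_coe]
      calc u = s + (u - s) := (add_tsub_cancel_of_le hsu').symm
        _ ≤ _ := by gcongr; exact le_ceilTime _ _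
    · exact iInf_le_of_le (⌈(u - s) * (n + 1)⌉₊, n) le_rfl

lemma IsLevy.measurable_expInf (hX : IsLevy P ℱ X) :
    Measurable fun p : (ℝ≥0∞ × ℝ≥0∞) × Ω => expInf X p.1.1 p.1.2 p.2 := by
  have h : (fun p : (ℝ≥0∞ × ℝ≥0∞) × Ω => expInf X p.1.1 p.1.2 p.2) = fun p =>
      if p.1.1 ≠ ∞ ∧ p.1.1 ≤ p.1.2 then ⨅ q : ℕ × ℕ, expPath X
        (min (p.1.1 + (((q.1 : ℝ≥0) / (q.2 + 1) : ℝ≥0) : ℝ≥0∞)) p.1.2).toNNReal p.2 else ∞ := by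
    funext p
    split_ifs with hp
    · exact hX.expInf_eq hp.1 hp.2 p.2
    · by_cases h1 : p.1.1 = ∞
      · rw [h1, expInf_top_left]
      · exact expInf_eq_top (not_le.1 fun h2 => hp ⟨h1, h2⟩)
  rw [h]
  refine Measurable.ite ?_ (Measurable.iInf fun q => ?_) measurable_const
  · refine MeasurableSet.inter ?_ ?_
    · exact (measurableSet_singleton _).compl.preimage (measurable_fst.comp measurable_fst)
    · exact measurableSet_le (measurable_fst.comp measurable_fst)
        (measurable_snd.comp measurable_fst)
  · refine hX.measurable_expPath_uncurry.comp (Measurable.prodMk ?_ measurable_snd)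
    refine ENNReal.measurable_toNNReal.comp (Measurable.min ?_ ?_)
    · exact (measurable_fst.comp measurable_fst).add_const _
    · exact measurable_snd.comp measurable_fst

lemma IsLevy.tendsto_expInf (hX : IsLevy P ℱ X) {s T : ℝ≥0∞} {v : ℕ → ℝ≥0∞}
    (hv : Tendsto v atTop (nhds s)) (hsv : ∀ n, s ≤ v n) (hsT : s ≠ T) (ω : Ω) :
    Tendsto (fun n => expInf X (v n) T ω) atTop (nhds (expInf X s T ω)) := by
  rcases hsT.lt_or_gt with hlt | hlt
  · refine tendsto_order.2 ⟨fun a ha => Eventually.of_forall fun n =>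
      ha.trans_le (expInf_mono (hsv n) ω), fun a ha => ?_⟩
    obtain ⟨u, hsu, huT, hua⟩ : ∃ u : ℝ≥0, s ≤ u ∧ (u : ℝ≥0∞) ≤ T ∧ expPath X u ω < a := by
      by_contra! hcon
      exact absurd ha (not_lt.2 (le_expInf hcon))
    rcases hsu.eq_or_lt with rfl | hsu
    · have hfin : ∀ᶠ n in atTop, v n < T := hv.eventually_lt_const hlt
      have hT0 : ∃ w : ℕ → ℝ≥0, (∀ n, u ≤ w n) ∧ Tendsto w atTop (nhds u) ∧
          ∀ᶠ n in atTop, ((w n : ℝ≥0) : ℝ≥0∞) = v n := by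
        have hne : ∀ᶠ n in atTop, v n < ∞ := hv.eventually_lt_const (by simp)
        refine ⟨fun n => max u (v n).toNNReal, fun n => le_max_left _ _, ?_, ?_⟩
        · have := (tendsto_const_nhds (x := u)).max ((ENNReal.tendsto_toNNReal (by simp)).comp hv)
          simpa using this
        · filter_upwards [hne] with n hn
          have h1 := hsv n
          lift v n to ℝ≥0 using hn.ne with y
          simpa using h1
      obtain ⟨w, huw, hw, hwv⟩ := hT0
      filter_upwards [hfin, hwv, (hX.tendsto_expPath hw huw ω).eventually_lt_const hua]
        with n h1 h2 h3
      exact (expInf_le h2.ge (h2 ▸ h1.le)).trans_lt h3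
    · filter_upwards [hv.eventually_lt_const hsu] with n hn
      exact (expInf_le hn.le huT).trans_lt hua
  · rw [expInf_eq_top hlt]
    refine tendsto_const_nhds.congr fun n => ?_
    rw [expInf_eq_top (hlt.trans_le (hsv n))]

end ExpPath

/-- `W` is independent of the σ-algebra `m` and has the same law as `W'`. -/
def FreshCopy [MeasurableSpace Ω] (P : Measure Ω) (m : MeasurableSpace Ω)
    (W W' : Ω → ℝ≥0∞) : Prop :=
  ∀ A, MeasurableSet[m] A → ∀ B, MeasurableSet B → P (A ∩ W ⁻¹' B) = P A * P (W' ⁻¹' B)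

lemma FreshCopy.lintegral_eq {m : MeasurableSpace Ω} [m0 : MeasurableSpace Ω] {P : Measure Ω}
    [IsProbabilityMeasure P] (hm : m ≤ m0)
    {W W' : Ω → ℝ≥0∞} (h : FreshCopy P m W W') (hW : Measurable W) (hW' : Measurable W')
    {α : Type*} [MeasurableSpace α] {Z : Ω → α} (hZ : Measurable[m] Z) {A : Set Ω}
    (hA : MeasurableSet[m] A) {F : α × ℝ≥0∞ → ℝ≥0∞} (hF : Measurable F) :
    ∫⁻ ω in A, F (Z ω, W ω) ∂P = ∫⁻ ω in A, ∫⁻ ω', F (Z ω, W' ω') ∂P ∂P := by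
  have hZ' : Measurable Z := hZ.mono hm le_rfl
  have hprod : ((P.restrict A).map Z).prod (P.map W') =
      (P.restrict A).map fun ω => (Z ω, W ω) := by
    have : IsFiniteMeasure ((P.restrict A).map Z) := inferInstance
    have : IsFiniteMeasure (P.map W') := inferInstance
    refine Measure.prod_eq fun S B hS hB => ?_
    rw [Measure.map_apply (hZ'.prodMk hW) (hS.prod hB), Measure.map_apply hZ' hS,
      Measure.map_apply hW' hB, Measure.restrict_apply ((hZ'.prodMk hW) (hS.prod hB)),
      Measure.restrict_apply (hZ' hS), ← h _ ((hZ hS).inter hA) _ hB]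
    congr 1
    ext ω
    simp only [mem_inter_iff, mem_preimage, mem_prod]
    tauto
  have h1 : ∫⁻ ω in A, F (Z ω, W ω) ∂P = ∫⁻ p, F p ∂((P.restrict A).map fun ω => (Z ω, W ω)) :=
    (lintegral_map hF (hZ'.prodMk hW)).symm
  rw [h1, ← hprod, lintegral_prod _ hF.aemeasurable,
    lintegral_map (Measurable.lintegral_prod_right' hF) hZ']
  refine lintegral_congr fun ω => ?_
  exact lintegral_map (f := fun y => F (Z ω, y))
    (hF.comp (measurable_const.prodMk measurable_id)) hW'

/-- Minimum of `e^{X_{s + t_k} - X_s}` over the finite grid `t_0, …, t_N`. -/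
def gridInf (X : ℝ → Ω → ℝ) (t : ℕ → ℝ≥0) (N : ℕ) (s : ℝ≥0) (ω : Ω) : ℝ≥0∞ :=
  ⨅ (k : ℕ) (_ : k ≤ N), expPath X (s + t k) ω / expPath X s ω

lemma gridInf_succ {X : ℝ → Ω → ℝ} (t : ℕ → ℝ≥0) (ht : Monotone t) (h0 : t 0 = 0)
    (N : ℕ) (s : ℝ≥0) (ω : Ω) :
    gridInf X t (N + 1) s ω = 1 ⊓ (expPath X (s + t 1) ω / expPath X s ω *
      gridInf X (fun k => t (k + 1) - t 1) N (s + t 1) ω) := by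
  have hE0 : expPath X (s + t 1) ω / expPath X s ω ≠ 0 := by
    rw [expPath_div]; simp [Real.exp_pos]
  have hE1 : expPath X (s + t 1) ω / expPath X s ω ≠ ∞ := by
    rw [expPath_div]; simp
  rw [gridInf, Nat.iInf_le_succ', h0, add_zero,
    ENNReal.div_self (expPath_ne_zero s ω) (expPath_ne_top s ω), gridInf,
    ENNReal.mul_iInf_of_ne hE0 hE1]
  congr 1
  refine iInf_congr fun k => ?_
  rw [ENNReal.mul_iInf_of_ne hE0 hE1]
  refine iInf_congr fun _ => ?_
  rw [add_assoc, add_tsub_cancel_of_le (ht (by omega)), mul_comm, ← mul_div_assoc, mul_comm,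
    expPath_mul_div]

section FreshCopy

variable {X : ℝ → Ω → ℝ} [m0 : MeasurableSpace Ω] {P : Measure Ω} {ℱ : Filtration ℝ m0}

lemma IsLevy.freshCopy_increment (hX : IsLevy P ℱ X) (s d : ℝ≥0) :
    FreshCopy P (ℱ s) (fun ω => expPath X (s + d) ω / expPath X s ω)
      (fun ω => expPath X d ω / expPath X 0 ω) := by
  intro A hA B hB
  have hg : Measurable fun y : ℝ => ENNReal.ofReal (Real.exp y) :=
    ENNReal.measurable_ofReal.comp Real.measurable_exp
  have hmeas : ∀ t : ℝ, 0 ≤ t → Measurable (X t) := fun t ht =>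
    ((hX.adapted t ht).mono (ℱ.le t)).measurable
  have key : ∀ a b : ℝ≥0, (fun ω => expPath X b ω / expPath X a ω) ⁻¹' B =
      (fun ω => X b ω - X a ω) ⁻¹' ((fun y : ℝ => ENNReal.ofReal (Real.exp y)) ⁻¹' B) := by
    intro a b
    ext ω
    simp only [mem_preimage, expPath_div]
  have hlaw : ∀ a b : ℝ≥0, a ≤ b → P ((fun ω => expPath X b ω / expPath X a ω) ⁻¹' B) =
      P.map (X (b - a)) ((fun y : ℝ => ENNReal.ofReal (Real.exp y)) ⁻¹' B) := by
    intro a b hab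
    have hm : Measurable fun ω => X b ω - X a ω := (hmeas b b.2).sub (hmeas a a.2)
    rw [key, ← hX.stationary a b a.2 (by exact_mod_cast hab), Measure.map_apply hm (hg hB)]
  have hind := (Indep_iff _ _ _).1 (hX.indepIncrements s (s + d : ℝ≥0) s.2 (by simp)) _ A
    ⟨_, hg hB, rfl⟩ hA
  rw [key, inter_comm, hind, ← key, mul_comm, hlaw s (s + d) le_self_add, hlaw 0 d zero_le]
  simp

lemma IsLevy.measurable_gridInf (hX : IsLevy P ℱ X) (t : ℕ → ℝ≥0) (N : ℕ) (s : ℝ≥0) :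
    Measurable (gridInf X t N s) :=
  Measurable.iInf fun _ => Measurable.iInf fun _ =>
    (hX.measurable_expPath' _).div (hX.measurable_expPath' _)

lemma IsLevy.freshCopy_gridInf (hX : IsLevy P ℱ X) (N : ℕ) (t : ℕ → ℝ≥0) (ht : Monotone t)
    (h0 : t 0 = 0) (s : ℝ≥0) : FreshCopy P (ℱ s) (gridInf X t N s) (gridInf X t N 0) := by
  have := hX.isProb
  suffices h : ∀ B, MeasurableSet B → ∃ c : ℝ≥0∞, ∀ (s : ℝ≥0) A, MeasurableSet[ℱ s] A →
      P (A ∩ gridInf X t N s ⁻¹' B) = P A * c by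
    intro A hA B hB
    obtain ⟨c, hc⟩ := h B hB
    have h1 := hc 0 univ MeasurableSet.univ
    rw [univ_inter, measure_univ, one_mul] at h1
    rw [hc s A hA, h1]
  clear s
  induction N generalizing t with
  | zero =>
    intro B hB
    refine ⟨if (1 : ℝ≥0∞) ∈ B then 1 else 0, fun s A _ => ?_⟩
    have h1 : gridInf X t 0 s = fun _ => 1 := by
      funext ω
      simp [gridInf, h0, ENNReal.div_self (expPath_ne_zero s ω) (expPath_ne_top s ω)]
    rw [h1]
    by_cases hB1 : (1 : ℝ≥0∞) ∈ B <;> simp [hB1]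
  | succ N ih =>
    intro B hB
    set t' : ℕ → ℝ≥0 := fun k => t (k + 1) - t 1 with ht'
    have hfresh : ∀ s : ℝ≥0, FreshCopy P (ℱ s) (gridInf X t' N s) (gridInf X t' N 0) := by
      intro s A hA B hB
      obtain ⟨c, hc⟩ := ih t' (fun i j hij => tsub_le_tsub_right (ht (by omega)) _)
        (by simp [ht']) B hB
      have h1 := hc 0 univ MeasurableSet.univ
      rw [univ_inter, measure_univ, one_mul] at h1
      rw [hc s A hA, h1]
    have hφ : Measurable fun p : ℝ≥0∞ × ℝ≥0∞ => B.indicator (fun _ => (1 : ℝ≥0∞))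
        (1 ⊓ p.1 * p.2) :=
      (measurable_const.indicator hB).comp
        (measurable_const.min (measurable_fst.mul measurable_snd))
    have hG : Measurable fun e : ℝ≥0∞ => ∫⁻ ω', B.indicator (fun _ => (1 : ℝ≥0∞))
        (1 ⊓ e * gridInf X t' N 0 ω') ∂P :=
      Measurable.lintegral_prod_right' (f := fun p : ℝ≥0∞ × Ω =>
        B.indicator (fun _ => (1 : ℝ≥0∞)) (1 ⊓ p.1 * gridInf X t' N 0 p.2))
        (hφ.comp (measurable_fst.prodMk ((hX.measurable_gridInf _ _ _).comp measurable_snd)))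
    refine ⟨∫⁻ ω, ∫⁻ ω', B.indicator (fun _ => (1 : ℝ≥0∞))
        (1 ⊓ (expPath X (t 1) ω / expPath X 0 ω) * gridInf X t' N 0 ω') ∂P ∂P, fun s A hA => ?_⟩
    have hstep : P (A ∩ gridInf X t (N + 1) s ⁻¹' B) =
        ∫⁻ ω in A, B.indicator (fun _ => (1 : ℝ≥0∞)) (1 ⊓ (expPath X (s + t 1) ω / expPath X s ω) *
          gridInf X t' N (s + t 1) ω) ∂P := by
      simp_rw [ht', ← gridInf_succ t ht h0]
      have h2 := lintegral_indicator_one (μ := P.restrict A)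
        (hX.measurable_gridInf t (N + 1) s hB)
      rw [Measure.restrict_apply (hX.measurable_gridInf t (N + 1) s hB), inter_comm] at h2
      rw [← h2]
      rfl
    have hle : (ℱ s : MeasurableSpace Ω) ≤ ℱ (s + t 1 : ℝ≥0) := ℱ.mono (by simp)
    have hE : Measurable[ℱ (s + t 1 : ℝ≥0)] fun ω => expPath X (s + t 1) ω / expPath X s ω :=
      (hX.measurable_expPath (s + t 1)).div ((hX.measurable_expPath s).mono hle le_rfl)
    rw [hstep, (hfresh (s + t 1)).lintegral_eq (ℱ.le _) (hX.measurable_gridInf _ _ _)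
      (hX.measurable_gridInf _ _ _) hE (hle _ hA) hφ]
    have h3 := (hX.freshCopy_increment s (t 1)).lintegral_eq (ℱ.le _) (hE.mono (ℱ.le _) le_rfl)
      ((hX.measurable_expPath' _).div (hX.measurable_expPath' _))
      (measurable_const (a := ())) hA (hG.comp measurable_snd)
    simp only [Function.comp_def] at h3
    rw [h3, lintegral_const, Measure.restrict_apply_univ, mul_comm]

/-- The equispaced grid of mesh `1 / (n + 1)`, frozen at time `T`. -/
def gridSeq (T : ℝ≥0∞) (n k : ℕ) : ℝ≥0 :=
  (min (((k : ℝ≥0) / (n + 1) : ℝ≥0) : ℝ≥0∞) T).toNNReal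

lemma coe_gridSeq (T : ℝ≥0∞) (n k : ℕ) :
    (gridSeq T n k : ℝ≥0∞) = min (((k : ℝ≥0) / (n + 1) : ℝ≥0) : ℝ≥0∞) T :=
  ENNReal.coe_toNNReal (ne_top_of_le_ne_top ENNReal.coe_ne_top (min_le_left _ _))

lemma monotone_gridSeq (T : ℝ≥0∞) (n : ℕ) : Monotone (gridSeq T n) := by
  intro i j hij
  rw [← ENNReal.coe_le_coe, coe_gridSeq, coe_gridSeq]
  gcongr

lemma gridSeq_zero (T : ℝ≥0∞) (n : ℕ) : gridSeq T n 0 = 0 := by simp [gridSeq]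

lemma IsLevy.tendsto_gridInf (hX : IsLevy P ℱ X) (T : ℝ≥0∞) (s : ℝ≥0) (ω : Ω) :
    Tendsto (fun n => gridInf X (gridSeq T n) ((n + 1) ^ 2) s ω) atTop
      (nhds (expInf X s (s + T) ω / expPath X s ω)) := by
  refine tendsto_order.2 ⟨fun a ha => Eventually.of_forall fun n => ha.trans_le ?_,
    fun a (ha : _ < a) => ?_⟩
  · refine le_iInf fun k => le_iInf fun _ => ?_
    refine ENNReal.div_le_div_right (expInf_le (by simp) ?_) _
    rw [ENNReal.coe_add, coe_gridSeq]
    gcongr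
    exact min_le_right _ _
  · rw [ENNReal.div_lt_iff (Or.inl (expPath_ne_zero s ω)) (Or.inl (expPath_ne_top s ω))] at ha
    obtain ⟨u, hsu, huT, hua⟩ : ∃ u : ℝ≥0, (s : ℝ≥0∞) ≤ u ∧ (u : ℝ≥0∞) ≤ s + T ∧
        expPath X u ω < a * expPath X s ω := by
      by_contra! hcon
      exact absurd ha (not_lt.2 (le_expInf hcon))
    obtain ⟨d, rfl⟩ := exists_add_of_le (ENNReal.coe_le_coe.1 hsu)
    have hdT : (d : ℝ≥0∞) ≤ T := by
      rw [ENNReal.coe_add] at huT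
      exact (ENNReal.add_le_add_iff_left ENNReal.coe_ne_top).1 huT
    have hle : ∀ n, d ≤ gridSeq T n ⌈d * (n + 1)⌉₊ := by
      intro n
      rw [← ENNReal.coe_le_coe, coe_gridSeq]
      exact le_min (ENNReal.coe_le_coe.2 (le_ceilTime n d)) hdT
    have hlim : Tendsto (fun n => s + gridSeq T n ⌈d * (n + 1)⌉₊) atTop (nhds (s + d)) := by
      refine tendsto_const_nhds.add (tendsto_of_tendsto_of_tendsto_of_le_of_le
        tendsto_const_nhds (tendsto_ceilTime d) hle fun n => ?_)
      rw [← ENNReal.coe_le_coe, coe_gridSeq]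
      exact min_le_left _ _
    filter_upwards [(hX.tendsto_expPath hlim (fun n => by gcongr; exact hle n)
      ω).eventually_lt_const hua, eventually_ge_atTop ⌈d⌉₊] with n hn hdn
    rw [← ENNReal.div_lt_iff (Or.inl (expPath_ne_zero s ω)) (Or.inl (expPath_ne_top s ω))] at hn
    refine lt_of_le_of_lt (iInf_le_of_le ⌈d * (n + 1)⌉₊ (iInf_le _ ?_)) hn
    rw [Nat.ceil_le]
    have : d ≤ n := (Nat.le_ceil d).trans (by exact_mod_cast hdn)
    push_cast
    calc d * (n + 1) ≤ (n + 1) * (n + 1) := by gcongr; exact this.trans (by simp)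
      _ = _ := by ring

lemma IsLevy.lintegral_restrict_sub_expInf (hX : IsLevy P ℱ X) {k : ℝ≥0∞} (hk : k ≠ ∞)
    (T : ℝ≥0∞) (s c : ℝ≥0) {A : Set Ω} (hA : MeasurableSet[ℱ s] A) :
    ∫⁻ ω in A, (k - c * expInf X s (s + T) ω) ∂P =
      ∫⁻ ω in A, ∫⁻ ω', (k - c * expPath X s ω * expInf X 0 T ω') ∂P ∂P := by
  have := hX.isProb
  have hcont : ∀ z : ℝ≥0∞, z ≠ ∞ → Continuous fun l => k - z * l := fun z hz =>
    (ENNReal.continuous_sub_left hk).comp (ENNReal.continuous_const_mul hz)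
  have hZfin : ∀ ω, (c : ℝ≥0∞) * expPath X s ω ≠ ∞ := fun ω =>
    ENNReal.mul_ne_top ENNReal.coe_ne_top (expPath_ne_top s ω)
  have hF : Measurable fun p : ℝ≥0∞ × ℝ≥0∞ => k - p.1 * p.2 :=
    measurable_const.sub (measurable_fst.mul measurable_snd)
  have hZ : Measurable[ℱ s] fun ω => (c : ℝ≥0∞) * expPath X s ω :=
    (hX.measurable_expPath s).const_mul _
  have hZ' := hZ.mono (ℱ.le _) le_rfl
  have hgrid : ∀ n, _ := fun n =>
    (hX.freshCopy_gridInf ((n + 1) ^ 2) (gridSeq T n) (monotone_gridSeq T n)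
      (gridSeq_zero T n) s).lintegral_eq (ℱ.le _) (hX.measurable_gridInf _ _ _)
      (hX.measurable_gridInf _ _ _) hZ hA hF
  have hkA : ∫⁻ _ in A, k ∂P ≠ ∞ := by
    rw [lintegral_const]
    exact ENNReal.mul_ne_top hk (measure_ne_top _ _)
  have hkP : ∫⁻ _ : Ω, k ∂P ≠ ∞ := by
    rw [lintegral_const]
    exact ENNReal.mul_ne_top hk (measure_ne_top _ _)
  have hl := tendsto_lintegral_of_dominated_convergence (μ := P.restrict A)
    (F := fun n ω => k - c * expPath X s ω * gridInf X (gridSeq T n) ((n + 1) ^ 2) s ω)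
    (f := fun ω => k - c * expInf X s (s + T) ω) (fun _ => k)
    (fun n => hF.comp (hZ'.prodMk (hX.measurable_gridInf _ _ _)))
    (fun n => Eventually.of_forall fun ω => tsub_le_self) hkA
    (Eventually.of_forall fun ω => by
      have h1 := ((hcont _ (hZfin ω)).tendsto _).comp (hX.tendsto_gridInf T s ω)
      have h2 : (c : ℝ≥0∞) * expPath X s ω * (expInf X s (s + T) ω / expPath X s ω) =
          c * expInf X s (s + T) ω := by
        rw [mul_assoc, ENNReal.mul_div_cancel (expPath_ne_zero s ω) (expPath_ne_top s ω)]
      rw [h2] at h1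
      exact h1)
  have hr := tendsto_lintegral_of_dominated_convergence (μ := P.restrict A)
    (F := fun n ω => ∫⁻ ω', (k - c * expPath X s ω *
      gridInf X (gridSeq T n) ((n + 1) ^ 2) 0 ω') ∂P)
    (f := fun ω => ∫⁻ ω', (k - c * expPath X s ω * expInf X 0 T ω') ∂P) (fun _ => k)
    (fun n => Measurable.lintegral_prod_right' (f := fun p : Ω × Ω => k - c * expPath X s p.1 *
      gridInf X (gridSeq T n) ((n + 1) ^ 2) 0 p.2) (hF.comp ((hZ'.comp measurable_fst).prodMk
        ((hX.measurable_gridInf _ _ _).comp measurable_snd))))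
    (fun n => Eventually.of_forall fun ω => (lintegral_mono fun ω' => tsub_le_self).trans
      (by simp)) hkA
    (Eventually.of_forall fun ω => by
      refine tendsto_lintegral_of_dominated_convergence (fun _ => k)
        (fun n => measurable_const.sub ((hX.measurable_gridInf _ _ _).const_mul _))
        (fun n => Eventually.of_forall fun ω => tsub_le_self) hkP ?_
      filter_upwards [hX.zero] with ω' hω'
      have h1 := ((hcont _ (hZfin ω)).tendsto _).comp (hX.tendsto_gridInf T 0 ω')
      have h2 : expPath X 0 ω' = 1 := by simp [expPath, hω']
      rw [h2, div_one, ENNReal.coe_zero, zero_add] at h1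
      exact h1)
  exact tendsto_nhds_unique hl (by simpa only [hgrid] using hr)

end FreshCopy

section KillLaw

/-- The law on `[0, ∞]` of an exponential time of rate `r`, with `e_0 = ∞`. -/
def killLaw (r : ℝ) : Measure ℝ≥0∞ :=
  if 0 < r then ((volume.restrict (Ioi (0 : ℝ))).withDensity
    fun t => ENNReal.ofReal (r * Real.exp (-(r * t)))).map ENNReal.ofReal else Measure.dirac ∞

lemma killLaw_zero : killLaw 0 = Measure.dirac ∞ := by simp [killLaw]

lemma measurable_expDensity (r : ℝ) :
    Measurable fun t : ℝ => ENNReal.ofReal (r * Real.exp (-(r * t))) := by fun_prop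

lemma lintegral_killLaw {r : ℝ} (hr : 0 < r) {f : ℝ≥0∞ → ℝ≥0∞} (hf : Measurable f) :
    ∫⁻ T, f T ∂killLaw r =
      ∫⁻ t in Ioi (0 : ℝ), ENNReal.ofReal (r * Real.exp (-(r * t))) * f (ENNReal.ofReal t) := by
  rw [killLaw, if_pos hr, lintegral_map hf ENNReal.measurable_ofReal,
    lintegral_withDensity_eq_lintegral_mul _ (measurable_expDensity r)
      (g := fun t => f (ENNReal.ofReal t)) (hf.comp ENNReal.measurable_ofReal)]
  rfl

lemma isProbabilityMeasure_killLaw {r : ℝ} (hr : 0 ≤ r) : IsProbabilityMeasure (killLaw r) := by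
  rcases hr.eq_or_lt with rfl | hr
  · rw [killLaw_zero]; infer_instance
  · refine ⟨?_⟩
    have h := lintegral_killLaw hr (measurable_const (a := (1 : ℝ≥0∞)))
    simp only [lintegral_const, one_mul, mul_one] at h
    have hexp := integrableOn_Ioi_comp_mul_left_iff (fun x => Real.exp (-x)) 0 hr
    have hint : IntegrableOn (fun t => Real.exp (-(r * t))) (Ioi 0) := by
      rw [hexp, mul_zero]
      exact integrableOn_exp_neg_Ioi 0
    rw [h, ← ofReal_integral_eq_lintegral_ofReal (hint.const_mul r)
      (Eventually.of_forall fun t => by positivity), integral_const_mul]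
    have h2 := integral_comp_mul_left_Ioi (fun x => Real.exp (-x)) 0 hr
    rw [h2, mul_zero, integral_exp_neg_Ioi_zero, smul_eq_mul, mul_one, mul_inv_cancel₀ hr.ne',
      ENNReal.ofReal_one]

lemma killLaw_singleton (r : ℝ) (s : ℝ≥0) : killLaw r {(s : ℝ≥0∞)} = 0 := by
  rw [killLaw]
  split_ifs with h
  · rw [Measure.map_apply ENNReal.measurable_ofReal (measurableSet_singleton _)]
    refine (withDensity_absolutelyContinuous _ _) (measure_mono_null
      (t := Iic 0 ∪ {(s : ℝ)}) (fun t ht => ?_) ?_)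
    · rcases le_or_gt t 0 with h0 | h0
      · exact Or.inl h0
      · refine Or.inr ?_
        have h1 : ENNReal.ofReal t = s := ht
        have h2 := congrArg ENNReal.toReal h1
        rw [ENNReal.toReal_ofReal h0.le] at h2
        simpa using h2
    · refine measure_union_null ?_ ?_
      · rw [Measure.restrict_apply measurableSet_Iic, Iic_inter_Ioi, Ioc_self, measure_empty]
      · exact measure_mono_null subset_rfl (by simp)
  · simp

lemma lintegral_killLaw_shift {r : ℝ} (hr : 0 ≤ r) (s : ℝ≥0) {f : ℝ≥0∞ → ℝ≥0∞}
    (hf : Measurable f) (h0 : ∀ T : ℝ≥0∞, T < s → f T = 0) :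
    ∫⁻ T, f T ∂killLaw r =
      ENNReal.ofReal (Real.exp (-(r * s))) * ∫⁻ T, f (s + T) ∂killLaw r := by
  rcases hr.eq_or_lt with rfl | hr
  · rw [killLaw_zero, lintegral_dirac, lintegral_dirac]
    simp
  · rw [lintegral_killLaw hr hf, lintegral_killLaw hr (f := fun T => f (s + T))
        (hf.comp (measurable_const_add _)),
      ← lintegral_const_mul _ (by fun_prop), ← lintegral_indicator measurableSet_Ioi,
      ← lintegral_indicator measurableSet_Ioi, ← lintegral_add_right_eq_self _ (s : ℝ)]
    refine lintegral_congr_ae ?_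
    filter_upwards [Measure.ae_ne volume (0 : ℝ)] with t ht
    rcases ht.lt_or_gt with h | h
    · rw [indicator_of_notMem (s := Ioi (0 : ℝ)) (a := t) (by simpa using h.le)]
      refine indicator_apply_eq_zero.2 fun hpos => ?_
      rw [h0, mul_zero]
      refine (ENNReal.ofReal_lt_iff_lt_toReal ?_ ENNReal.coe_ne_top).2 ?_
      · exact le_of_lt hpos
      · simpa using h
    · rw [indicator_of_mem (s := Ioi (0 : ℝ)) (a := t) h,
        indicator_of_mem (s := Ioi (0 : ℝ)) (a := t + s) (add_pos_of_pos_of_nonneg h s.2),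
        ← mul_assoc, ← ENNReal.ofReal_mul (Real.exp_pos _).le, ENNReal.ofReal_add h.le s.coe_nonneg,
        ENNReal.ofReal_coe_nnreal, add_comm (ENNReal.ofReal t)]
      congr 2
      rw [mul_left_comm, ← Real.exp_add]
      ring_nf

end KillLaw

section StrongMarkov

variable {X : ℝ → Ω → ℝ}

lemma expInf_zero_ne_top (T : ℝ≥0∞) (ω : Ω) : expInf X 0 T ω ≠ ∞ :=
  ne_top_of_le_ne_top (expPath_ne_top 0 ω) (expInf_le (u := 0) (by simp) (by simp))

/-- `e^{-rτ} f(e^{x + X_τ}) 1_{τ < ∞}` with `c = e^x`. -/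
def discounted (X : ℝ → Ω → ℝ) (r : ℝ) (c : ℝ≥0∞) (f : ℝ≥0∞ → ℝ≥0∞) (τ : ℝ≥0∞) (ω : Ω) : ℝ≥0∞ :=
  if τ = ∞ then 0 else
    ENNReal.ofReal (Real.exp (-(r * τ.toReal))) * f (c * expPath X τ.toNNReal ω)

lemma exp_discount_le_one {r : ℝ} (hr : 0 ≤ r) (τ : ℝ≥0∞) :
    ENNReal.ofReal (Real.exp (-(r * τ.toReal))) ≤ 1 := by
  rw [ENNReal.ofReal_le_one, Real.exp_le_one_iff]
  have := mul_nonneg hr (ENNReal.toReal_nonneg (a := τ))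
  linarith

lemma discounted_le {r : ℝ} (hr : 0 ≤ r) {c k : ℝ≥0∞} {f : ℝ≥0∞ → ℝ≥0∞} (hf : ∀ z, f z ≤ k)
    (τ : ℝ≥0∞) (ω : Ω) : discounted X r c f τ ω ≤ k := by
  rw [discounted]
  split_ifs
  · exact zero_le
  · calc _ ≤ 1 * k := mul_le_mul' (exp_discount_le_one hr τ) (hf _)
      _ = k := one_mul k

variable [m0 : MeasurableSpace Ω] {P : Measure Ω} {ℱ : Filtration ℝ m0}

/-- `E[(k - z e^{X̲_{e_r}})^+]` as an extended nonnegative real. -/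
def infPut (P : Measure Ω) (X : ℝ → Ω → ℝ) (r : ℝ) (k z : ℝ≥0∞) : ℝ≥0∞ :=
  ∫⁻ T, ∫⁻ ω, (k - z * expInf X 0 T ω) ∂P ∂killLaw r

lemma IsLevy.measurable_sub_expInf (hX : IsLevy P ℱ X) (k : ℝ≥0∞) :
    Measurable fun p : (ℝ≥0∞ × ℝ≥0∞) × ℝ≥0∞ × Ω => k - p.1.1 * expInf X p.2.1 p.1.2 p.2.2 :=
  measurable_const.sub ((measurable_fst.comp measurable_fst).mul (hX.measurable_expInf.comp
    (((measurable_fst.comp measurable_snd).prodMk (measurable_snd.comp measurable_fst)).prodMk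
      (measurable_snd.comp measurable_snd))))

lemma IsLevy.measurable_lintegral_sub_expInf (hX : IsLevy P ℱ X) (k : ℝ≥0∞) :
    Measurable fun p : ℝ≥0∞ × ℝ≥0∞ => ∫⁻ ω, (k - p.1 * expInf X 0 p.2 ω) ∂P := by
  have := hX.isProb
  exact Measurable.lintegral_prod_right' (f := fun p : (ℝ≥0∞ × ℝ≥0∞) × Ω =>
    k - p.1.1 * expInf X 0 p.1.2 p.2) ((hX.measurable_sub_expInf k).comp
      (measurable_fst.prodMk (measurable_const.prodMk measurable_snd)))

lemma IsLevy.measurable_infPut (hX : IsLevy P ℱ X) {r : ℝ} (hr : 0 ≤ r) (k : ℝ≥0∞) :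
    Measurable (infPut P X r k) := by
  have := isProbabilityMeasure_killLaw hr
  exact Measurable.lintegral_prod_right' (hX.measurable_lintegral_sub_expInf k)

lemma IsLevy.infPut_le (hX : IsLevy P ℱ X) {r : ℝ} (hr : 0 ≤ r) (k z : ℝ≥0∞) :
    infPut P X r k z ≤ k := by
  have := isProbabilityMeasure_killLaw hr
  have := hX.isProb
  calc infPut P X r k z ≤ ∫⁻ _, ∫⁻ _, k ∂P ∂killLaw r :=
        lintegral_mono fun T => lintegral_mono fun ω => tsub_le_self
    _ = k := by simp

lemma IsLevy.tendsto_infPut (hX : IsLevy P ℱ X) {r : ℝ} (hr : 0 ≤ r) {k : ℝ≥0∞} (hk : k ≠ ∞)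
    {v : ℕ → ℝ≥0∞} {z : ℝ≥0∞} (hv : Tendsto v atTop (nhds z)) :
    Tendsto (fun n => infPut P X r k (v n)) atTop (nhds (infPut P X r k z)) := by
  have := isProbabilityMeasure_killLaw hr
  have := hX.isProb
  refine tendsto_lintegral_of_dominated_convergence (fun _ => k)
    (fun n => (hX.measurable_lintegral_sub_expInf k).comp
      (measurable_const.prodMk measurable_id))
    (fun n => Eventually.of_forall fun T => (lintegral_mono fun ω => tsub_le_self).trans
      (by simp)) (by simpa using hk) (Eventually.of_forall fun T => ?_)
  refine tendsto_lintegral_of_dominated_convergence (fun _ => k)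
    (fun n => (hX.measurable_sub_expInf k).comp ((measurable_const (a := (v n, T))).prodMk
      ((measurable_const (a := (0 : ℝ≥0∞))).prodMk measurable_id)))
    (fun n => Eventually.of_forall fun T => tsub_le_self) (by simpa using hk)
    (Eventually.of_forall fun ω => ?_)
  exact ((ENNReal.continuous_sub_left hk).tendsto _).comp
    (ENNReal.Tendsto.mul_const hv (Or.inr (expInf_zero_ne_top T ω)))

/-- The Markov property at a deterministic time, for the infimum up to an independent
exponential time. -/
lemma IsLevy.markov_expInf (hX : IsLevy P ℱ X) {r : ℝ} (hr : 0 ≤ r) {k : ℝ≥0∞} (hk : k ≠ ∞)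
    (c s : ℝ≥0) (hc : c ≠ 0) {A : Set Ω} (hA : MeasurableSet[ℱ s] A) :
    ∫⁻ ω in A, ∫⁻ T, (k - c * expInf X s T ω) ∂killLaw r ∂P =
      ∫⁻ ω in A, ENNReal.ofReal (Real.exp (-(r * s))) *
        infPut P X r k (c * expPath X s ω) ∂P := by
  have := isProbabilityMeasure_killLaw hr
  have := hX.isProb
  have hc' : (c : ℝ≥0∞) ≠ 0 := by simpa using hc
  have hY : Measurable fun ω => (c : ℝ≥0∞) * expPath X s ω :=
    (hX.measurable_expPath' s).const_mul _
  have hshift : ∀ ω, ∫⁻ T, (k - c * expInf X s T ω) ∂killLaw r =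
      ENNReal.ofReal (Real.exp (-(r * s))) *
        ∫⁻ T, (k - c * expInf X s (s + T) ω) ∂killLaw r := fun ω => by
    refine lintegral_killLaw_shift hr s (f := fun T => k - c * expInf X s T ω)
      ((hX.measurable_sub_expInf k).comp ((measurable_const.prodMk measurable_id).prodMk
        (measurable_const.prodMk measurable_const))) fun T hT => ?_
    rw [expInf_eq_top hT, ENNReal.mul_top hc', ENNReal.sub_top]
  have hm1 : Measurable fun p : Ω × ℝ≥0∞ => k - c * expInf X s (s + p.2) p.1 :=
    (hX.measurable_sub_expInf k).comp ((measurable_const.prodMk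
      (measurable_snd.const_add _)).prodMk (measurable_const.prodMk measurable_fst))
  have hm2 : Measurable fun p : ℝ≥0∞ × Ω =>
      ∫⁻ ω', (k - c * expPath X s p.2 * expInf X 0 p.1 ω') ∂P :=
    (hX.measurable_lintegral_sub_expInf k).comp
      ((hY.comp measurable_snd).prodMk measurable_fst)
  simp_rw [hshift]
  have e1 := lintegral_const_mul (μ := P.restrict A) (ENNReal.ofReal (Real.exp (-(r * s))))
    (f := fun ω => ∫⁻ T, (k - c * expInf X s (s + T) ω) ∂killLaw r)
    (Measurable.lintegral_prod_right' hm1)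
  have e2 := lintegral_const_mul (μ := P.restrict A) (ENNReal.ofReal (Real.exp (-(r * s))))
    (f := fun ω => infPut P X r k (c * expPath X s ω)) ((hX.measurable_infPut hr k).comp hY)
  have e3 := lintegral_lintegral_swap (μ := P.restrict A) (ν := killLaw r)
    (f := fun ω T => k - c * expInf X s (s + T) ω) hm1.aemeasurable
  have e4 := lintegral_lintegral_swap (μ := killLaw r) (ν := P.restrict A)
    (f := fun T ω => ∫⁻ ω', (k - c * expPath X s ω * expInf X 0 T ω') ∂P) hm2.aemeasurable
  rw [e1, e2, e3]
  simp_rw [hX.lintegral_restrict_sub_expInf hk _ s c hA]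
  rw [e4]
  rfl

/-- Approximation of a `[0, ∞]`-valued time from the right on a grid. -/
def ceilTimeE (n : ℕ) (τ : ℝ≥0∞) : ℝ≥0∞ := if τ = ∞ then ∞ else ceilTime n τ.toNNReal

lemma ceilTimeE_coe (n : ℕ) (t : ℝ≥0) : ceilTimeE n t = ceilTime n t := by simp [ceilTimeE]

lemma le_ceilTimeE (n : ℕ) (τ : ℝ≥0∞) : τ ≤ ceilTimeE n τ := by
  by_cases h : τ = ∞
  · simp [ceilTimeE, h]
  · lift τ to ℝ≥0 using h
    rw [ceilTimeE_coe]
    exact_mod_cast le_ceilTime n τ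

lemma tendsto_ceilTimeE (τ : ℝ≥0∞) : Tendsto (fun n => ceilTimeE n τ) atTop (nhds τ) := by
  by_cases h : τ = ∞
  · simp [ceilTimeE, h]
  · lift τ to ℝ≥0 using h
    simp_rw [ceilTimeE_coe]
    exact ENNReal.tendsto_coe.2 (tendsto_ceilTime τ)

lemma measurable_ceilTimeE (n : ℕ) : Measurable (ceilTimeE n) := by
  refine Measurable.ite (measurableSet_singleton _) measurable_const ?_
  refine measurable_coe_nnreal_ennreal.comp (Measurable.div_const ?_ _)
  have h : Measurable fun t : ℝ≥0∞ => ⌈t.toNNReal * ((n : ℝ≥0) + 1)⌉₊ :=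
    Nat.measurable_ceil.comp (ENNReal.measurable_toNNReal.mul_const _)
  exact (measurable_from_top (f := fun k : ℕ => (k : ℝ≥0))).comp h

lemma IsStopTime.measurableSet_le {τ : Ω → ℝ≥0∞} (hτ : IsStopTime ℱ τ) (t : ℝ≥0) :
    MeasurableSet[ℱ t] {ω | τ ω ≤ t} := by
  simpa using hτ t t.2

lemma IsStopTime.measurable {τ : Ω → ℝ≥0∞} (hτ : IsStopTime ℱ τ) : Measurable τ := by
  refine measurable_of_Iic fun a => ?_
  by_cases h : a = ∞
  · simp [h]
  · lift a to ℝ≥0 using h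
    exact ℱ.le _ _ (hτ.measurableSet_le a)

lemma IsStopTime.measurableSet_ceilTime_eq {τ : Ω → ℝ≥0∞} (hτ : IsStopTime ℱ τ) (n j : ℕ) :
    MeasurableSet[ℱ ((j : ℝ≥0) / (n + 1) : ℝ≥0)]
      {ω | τ ω ≠ ∞ ∧ ⌈(τ ω).toNNReal * (n + 1)⌉₊ = j} := by
  have hle : ∀ i : ℕ, {ω | τ ω ≠ ∞ ∧ ⌈(τ ω).toNNReal * (n + 1)⌉₊ ≤ i} =
      {ω | τ ω ≤ ((i : ℝ≥0) / (n + 1) : ℝ≥0)} := by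
    intro i
    ext ω
    simp only [mem_ofPred_eq]
    by_cases h : τ ω = ∞
    · simp only [h, ne_eq, not_true, false_and, top_le_iff, ENNReal.coe_ne_top]
    · generalize τ ω = y at h
      lift y to ℝ≥0 using h
      rw [ENNReal.coe_le_coe, le_div_iff₀ (by positivity), Nat.ceil_le]
      simp
  cases j with
  | zero =>
    have h := hτ.measurableSet_le (((0 : ℕ) : ℝ≥0) / (n + 1))
    rw [← hle 0] at h
    simpa only [Nat.le_zero] using h
  | succ j =>
    have h : {ω | τ ω ≠ ∞ ∧ ⌈(τ ω).toNNReal * (n + 1)⌉₊ = j + 1} =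
        {ω | τ ω ≤ (((j + 1 : ℕ) : ℝ≥0) / (n + 1) : ℝ≥0)} \
          {ω | τ ω ≤ ((j : ℝ≥0) / (n + 1) : ℝ≥0)} := by
      rw [← hle, ← hle]
      ext ω
      simp only [mem_ofPred_eq, Set.mem_sdiff, not_and]
      constructor
      · rintro ⟨h1, h2⟩
        exact ⟨⟨h1, h2.le⟩, fun _ => by omega⟩
      · rintro ⟨⟨h1, h2⟩, h3⟩
        exact ⟨h1, by have := h3 h1; omega⟩
    rw [h]
    refine (hτ.measurableSet_le _).diff (ℱ.mono ?_ _ (hτ.measurableSet_le _))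
    rw [NNReal.coe_le_coe]
    gcongr
    simp

lemma IsLevy.measurable_discounted (hX : IsLevy P ℱ X) (r : ℝ) (c : ℝ≥0∞) {f : ℝ≥0∞ → ℝ≥0∞}
    (hf : Measurable f) {τ : Ω → ℝ≥0∞} (hτ : Measurable τ) :
    Measurable fun ω => discounted X r c f (τ ω) ω := by
  refine Measurable.ite (hτ (measurableSet_singleton _)) measurable_const (Measurable.mul ?_ ?_)
  · exact ENNReal.measurable_ofReal.comp (Real.measurable_exp.comp
      ((ENNReal.measurable_toReal.comp hτ).const_mul r).neg)
  · exact hf.comp ((hX.measurable_expPath_uncurry.comp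
      ((ENNReal.measurable_toNNReal.comp hτ).prodMk measurable_id)).const_mul c)

lemma IsLevy.strongMarkov_ceilTimeE (hX : IsLevy P ℱ X) {r : ℝ} (hr : 0 ≤ r) {k : ℝ≥0∞}
    (hk : k ≠ ∞) {c : ℝ≥0} (hc : c ≠ 0) {τ : Ω → ℝ≥0∞} (hτ : IsStopTime ℱ τ) (n : ℕ) :
    ∫⁻ ω, ∫⁻ T, (k - c * expInf X (ceilTimeE n (τ ω)) T ω) ∂killLaw r ∂P =
      ∫⁻ ω, discounted X r c (infPut P X r k) (ceilTimeE n (τ ω)) ω ∂P := by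
  set A : ℕ → Set Ω := fun j => {ω | τ ω ≠ ∞ ∧ ⌈(τ ω).toNNReal * (n + 1)⌉₊ = j} with hA
  have hAm : ∀ j, MeasurableSet (A j) := fun j =>
    ℱ.le _ _ (hτ.measurableSet_ceilTime_eq n j)
  have hdisj : Pairwise (Function.onFun Disjoint A) := fun i j hij =>
    Set.disjoint_left.2 fun ω hi hj => hij (hi.2.symm.trans hj.2)
  have hU : ⋃ j, A j = {ω | τ ω ≠ ∞} := by
    ext ω
    simp [hA]
  have hsplit : ∀ f : Ω → ℝ≥0∞, (∀ ω, τ ω = ∞ → f ω = 0) →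
      ∫⁻ ω, f ω ∂P = ∑' j, ∫⁻ ω in A j, f ω ∂P := fun f hf => by
    rw [← lintegral_iUnion hAm hdisj, hU]
    refine (setLIntegral_eq_of_support_subset ?_).symm
    intro ω hω h
    exact hω (hf ω h)
  have hc' : (c : ℝ≥0∞) ≠ 0 := by simpa using hc
  rw [hsplit _ fun ω h => ?_, hsplit _ fun ω h => ?_]
  · refine tsum_congr fun j => ?_
    have hval : ∀ ω ∈ A j, ceilTimeE n (τ ω) = ((j : ℝ≥0) / (n + 1) : ℝ≥0) := fun ω hω => by
      rw [ceilTimeE, if_neg hω.1, ceilTime, hω.2]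
    refine (setLIntegral_congr_fun (hAm j) fun ω hω => ?_).trans
      ((hX.markov_expInf hr hk c _ hc (hτ.measurableSet_ceilTime_eq n j)).trans
        (setLIntegral_congr_fun (hAm j) fun ω hω => ?_))
    · simp only [hval ω hω]
    · simp only [hval ω hω, discounted, ENNReal.coe_ne_top, if_false,
        ENNReal.coe_toReal, ENNReal.toNNReal_coe]
  · simp [discounted, ceilTimeE, h]
  · simp [ceilTimeE, h, expInf_top_left, ENNReal.mul_top hc']

/-- The strong Markov property for the infimum up to an independent exponential time. -/
lemma IsLevy.strongMarkov_expInf (hX : IsLevy P ℱ X) {r : ℝ} (hr : 0 ≤ r) {k : ℝ≥0∞}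
    (hk : k ≠ ∞) {c : ℝ≥0} (hc : c ≠ 0) {τ : Ω → ℝ≥0∞} (hτ : IsStopTime ℱ τ) :
    ∫⁻ ω, ∫⁻ T, (k - c * expInf X (τ ω) T ω) ∂killLaw r ∂P =
      ∫⁻ ω, discounted X r c (infPut P X r k) (τ ω) ω ∂P := by
  have := isProbabilityMeasure_killLaw hr
  have := hX.isProb
  have hρ : ∀ n, Measurable fun ω => ceilTimeE n (τ ω) := fun n =>
    (measurable_ceilTimeE n).comp hτ.measurable
  have hm : ∀ n, Measurable fun p : Ω × ℝ≥0∞ =>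
      k - c * expInf X (ceilTimeE n (τ p.1)) p.2 p.1 := fun n =>
    (hX.measurable_sub_expInf k).comp ((measurable_const.prodMk measurable_snd).prodMk
      (((hρ n).comp measurable_fst).prodMk measurable_fst))
  have hkP : ∫⁻ _ : Ω, k ∂P ≠ ∞ := by simpa using hk
  have hin : ∀ ω, Tendsto (fun n => ∫⁻ T, (k - c * expInf X (ceilTimeE n (τ ω)) T ω) ∂killLaw r)
      atTop (nhds (∫⁻ T, (k - c * expInf X (τ ω) T ω) ∂killLaw r)) := fun ω => by
    have hmω : ∀ n, Measurable fun T : ℝ≥0∞ => k - c * expInf X (ceilTimeE n (τ ω)) T ω :=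
      fun n => (hX.measurable_sub_expInf k).comp
        ((measurable_prodMk_left (x := (c : ℝ≥0∞))).prodMk
          (measurable_const (a := (ceilTimeE n (τ ω), ω))))
    have hle : ∀ n, ∀ᵐ T ∂killLaw r, k - c * expInf X (ceilTimeE n (τ ω)) T ω ≤ k := fun n =>
      Eventually.of_forall fun T => tsub_le_self
    have hki : ∫⁻ _, k ∂killLaw r ≠ ∞ := by simpa using hk
    refine tendsto_lintegral_of_dominated_convergence (fun _ => k) hmω hle hki ?_
    by_cases h : τ ω = ∞
    · simp [h, ceilTimeE, expInf_top_left]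
    · have hne : ∀ᵐ T ∂killLaw r, T ≠ τ ω := by
        have h0 := killLaw_singleton r (τ ω).toNNReal
        rw [ENNReal.coe_toNNReal h] at h0
        exact measure_eq_zero_iff_ae_notMem.1 h0
      filter_upwards [hne] with T hT
      exact (((ENNReal.continuous_sub_left hk).comp
        (ENNReal.continuous_const_mul ENNReal.coe_ne_top)).tendsto _).comp
          (hX.tendsto_expInf (tendsto_ceilTimeE (τ ω)) (fun n => le_ceilTimeE n _) hT.symm ω)
  have hl := tendsto_lintegral_of_dominated_convergence (μ := P)
    (F := fun n ω => ∫⁻ T, (k - c * expInf X (ceilTimeE n (τ ω)) T ω) ∂killLaw r)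
    (f := fun ω => ∫⁻ T, (k - c * expInf X (τ ω) T ω) ∂killLaw r) (fun _ => k)
    (fun n => Measurable.lintegral_prod_right' (hm n))
    (fun n => Eventually.of_forall fun ω => (lintegral_mono fun T => tsub_le_self).trans
      (by simp)) hkP
    (Eventually.of_forall hin)
  have hrr := tendsto_lintegral_of_dominated_convergence (μ := P)
    (F := fun n ω => discounted X r c (infPut P X r k) (ceilTimeE n (τ ω)) ω)
    (f := fun ω => discounted X r c (infPut P X r k) (τ ω) ω) (fun _ => k)
    (fun n => hX.measurable_discounted r c (hX.measurable_infPut hr k) (hρ n))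
    (fun n => Eventually.of_forall fun ω => discounted_le hr (hX.infPut_le hr k) _ _) hkP
    (Eventually.of_forall fun ω => by
      by_cases h : τ ω = ∞
      · simp [h, ceilTimeE, discounted]
      · generalize τ ω = y at h
        lift y to ℝ≥0 using h
        simp only [ceilTimeE_coe, discounted, ENNReal.coe_ne_top, if_false, ENNReal.coe_toReal,
          ENNReal.toNNReal_coe]
        refine ENNReal.Tendsto.mul ?_ (Or.inr ?_) ?_ (Or.inr ENNReal.ofReal_ne_top)
        · refine ENNReal.tendsto_ofReal ((Real.continuous_exp.tendsto _).comp ?_)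
          exact ((NNReal.tendsto_coe.2 (tendsto_ceilTime y)).const_mul r).neg
        · exact ne_top_of_le_ne_top hk (hX.infPut_le hr k _)
        · exact hX.tendsto_infPut hr hk (ENNReal.Tendsto.const_mul
            (hX.tendsto_expPath (tendsto_ceilTime y) (fun n => le_ceilTime n y) ω)
            (Or.inr ENNReal.coe_ne_top)))
  simp_rw [hX.strongMarkov_ceilTimeE hr hk hc hτ] at hl
  exact tendsto_nhds_unique hl hrr

end StrongMarkov

section OptimalStopping

variable {X : ℝ → Ω → ℝ}

lemma mul_discounted (a : ℝ≥0∞) (r : ℝ) (c : ℝ≥0∞) (f : ℝ≥0∞ → ℝ≥0∞) (τ : ℝ≥0∞) (ω : Ω) :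
    a * discounted X r c f τ ω = discounted X r c (fun z => a * f z) τ ω := by
  rw [discounted, discounted]
  split_ifs
  · exact mul_zero a
  · exact mul_left_comm _ _ _

/-- The first passage time of `c e^{X}` strictly below `k`. -/
def passTime (X : ℝ → Ω → ℝ) (c k : ℝ≥0∞) (ω : Ω) : ℝ≥0∞ :=
  ⨅ (u : ℝ≥0) (_ : c * expPath X u ω < k), (u : ℝ≥0∞)

lemma passTime_lt_iff {c k v : ℝ≥0∞} {ω : Ω} :
    passTime X c k ω < v ↔ ∃ u : ℝ≥0, c * expPath X u ω < k ∧ (u : ℝ≥0∞) < v := by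
  simp only [passTime, iInf_lt_iff, exists_prop]

lemma sub_expInf_le_passTime {c : ℝ≥0} (hc : c ≠ 0) (k T : ℝ≥0∞) (ω : Ω) :
    k - c * expInf X 0 T ω ≤ k - c * expInf X (passTime X c k ω) T ω := by
  rw [← tsub_min (a := k) (b := c * expInf X (passTime X c k ω) T ω)]
  refine tsub_le_tsub_left ?_ _
  have hc' : (c : ℝ≥0∞) ≠ 0 := by simpa using hc
  rw [← ENNReal.div_le_iff' hc' ENNReal.coe_ne_top]
  refine le_expInf fun u _ huT => ?_
  rw [ENNReal.div_le_iff' hc' ENNReal.coe_ne_top]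
  rcases le_or_gt (passTime X c k ω) u with h | h
  · exact (min_le_right _ _).trans (mul_le_mul_right (expInf_le h huT) _)
  · refine (min_le_left _ _).trans (not_lt.1 fun hlt => ?_)
    exact lt_irrefl _ (h.trans_le (iInf₂_le u hlt))

variable [m0 : MeasurableSpace Ω] {P : Measure Ω} {ℱ : Filtration ℝ m0}

/-- `E[e^{X̲_{e_r}}]` as an extended nonnegative real. -/
def infMean (P : Measure Ω) (X : ℝ → Ω → ℝ) (r : ℝ) : ℝ≥0∞ :=
  ∫⁻ T, ∫⁻ ω, expInf X 0 T ω ∂P ∂killLaw r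

lemma IsLevy.measurable_expInf_zero (hX : IsLevy P ℱ X) (T : ℝ≥0∞) :
    Measurable fun ω => expInf X 0 T ω :=
  hX.measurable_expInf.comp (measurable_prodMk_left (x := ((0 : ℝ≥0∞), T)))

lemma IsLevy.measurable_lintegral_expInf (hX : IsLevy P ℱ X) :
    Measurable fun T => ∫⁻ ω, expInf X 0 T ω ∂P := by
  have := hX.isProb
  exact Measurable.lintegral_prod_right' (f := fun p : ℝ≥0∞ × Ω => expInf X 0 p.1 p.2)
    (hX.measurable_expInf.comp
      (((measurable_const (a := (0 : ℝ≥0∞))).prodMk measurable_fst).prodMk measurable_snd))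

lemma IsLevy.expInf_zero_le_one (hX : IsLevy P ℱ X) (T : ℝ≥0∞) :
    ∀ᵐ ω ∂P, expInf X 0 T ω ≤ 1 := by
  filter_upwards [hX.zero] with ω hω
  refine (expInf_le (u := 0) (by simp) (by simp)).trans ?_
  simp [expPath, hω]

lemma IsLevy.lintegral_expInf_le_one (hX : IsLevy P ℱ X) (T : ℝ≥0∞) :
    ∫⁻ ω, expInf X 0 T ω ∂P ≤ 1 := by
  have := hX.isProb
  calc _ ≤ ∫⁻ _, 1 ∂P := lintegral_mono_ae (hX.expInf_zero_le_one T)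
    _ = 1 := by simp

lemma IsLevy.infMean_le_one (hX : IsLevy P ℱ X) {r : ℝ} (hr : 0 ≤ r) : infMean P X r ≤ 1 := by
  have := isProbabilityMeasure_killLaw hr
  calc _ ≤ ∫⁻ _, 1 ∂killLaw r := lintegral_mono hX.lintegral_expInf_le_one
    _ = 1 := by simp

lemma IsLevy.sub_le_infPut (hX : IsLevy P ℱ X) {r : ℝ} (hr : 0 ≤ r) (k z : ℝ≥0∞) :
    k - z * infMean P X r ≤ infPut P X r k z := by
  have := isProbabilityMeasure_killLaw hr
  have := hX.isProb
  have h1 := lintegral_sub_le (μ := killLaw r) (fun T => z * ∫⁻ ω, expInf X 0 T ω ∂P)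
    (fun _ => k) (hX.measurable_lintegral_expInf.const_mul z)
  rw [lintegral_const_mul _ hX.measurable_lintegral_expInf, lintegral_const, measure_univ,
    mul_one] at h1
  refine h1.trans (lintegral_mono fun T => ?_)
  have h2 := lintegral_sub_le (μ := P) (fun ω => z * expInf X 0 T ω) (fun _ => k)
    ((hX.measurable_expInf_zero T).const_mul z)
  rwa [lintegral_const_mul _ (hX.measurable_expInf_zero T), lintegral_const, measure_univ,
    mul_one] at h2

lemma IsLevy.infPut_eq (hX : IsLevy P ℱ X) {r : ℝ} (hr : 0 ≤ r) {k z : ℝ≥0∞} (hk : k ≠ ∞)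
    (hz : z ≤ k) : infPut P X r k z = k - z * infMean P X r := by
  have := isProbabilityMeasure_killLaw hr
  have := hX.isProb
  have hz' : z ≠ ∞ := ne_top_of_le_ne_top hk hz
  have h1 : ∀ T, ∫⁻ ω, (k - z * expInf X 0 T ω) ∂P = k - z * ∫⁻ ω, expInf X 0 T ω ∂P := by
    intro T
    rw [lintegral_sub ((hX.measurable_expInf_zero T).const_mul z),
      lintegral_const_mul _ (hX.measurable_expInf_zero T), lintegral_const, measure_univ, mul_one]
    · rw [lintegral_const_mul _ (hX.measurable_expInf_zero T)]
      exact ENNReal.mul_ne_top hz' (ne_top_of_le_ne_top ENNReal.one_ne_top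
        (hX.lintegral_expInf_le_one T))
    · filter_upwards [hX.expInf_zero_le_one T] with ω hω
      calc z * expInf X 0 T ω ≤ k * 1 := mul_le_mul' hz hω
        _ = k := mul_one k
  simp_rw [infPut, h1]
  rw [lintegral_sub (hX.measurable_lintegral_expInf.const_mul z),
    lintegral_const_mul _ hX.measurable_lintegral_expInf, lintegral_const, measure_univ, mul_one,
    infMean]
  · rw [lintegral_const_mul _ hX.measurable_lintegral_expInf]
    exact ENNReal.mul_ne_top hz' (ne_top_of_le_ne_top ENNReal.one_ne_top (hX.infMean_le_one hr))
  · refine Eventually.of_forall fun T => ?_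
    calc z * _ ≤ k * 1 := mul_le_mul' hz (hX.lintegral_expInf_le_one T)
      _ = k := mul_one k

lemma IsLevy.mul_infMean_sub (hX : IsLevy P ℱ X) {r : ℝ} (hr : 0 ≤ r) (κ z : ℝ≥0∞) :
    infMean P X r * (κ - z) = κ * infMean P X r - z * infMean P X r := by
  rw [ENNReal.mul_sub fun _ _ => ne_top_of_le_ne_top ENNReal.one_ne_top (hX.infMean_le_one hr),
    mul_comm, mul_comm _ z]

lemma IsLevy.lintegral_lintegral_killLaw (hX : IsLevy P ℱ X) {r : ℝ} (hr : 0 ≤ r) (k c : ℝ≥0∞) :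
    ∫⁻ ω, ∫⁻ T, (k - c * expInf X 0 T ω) ∂killLaw r ∂P = infPut P X r k c := by
  have := isProbabilityMeasure_killLaw hr
  have := hX.isProb
  have hm : Measurable fun p : Ω × ℝ≥0∞ => k - c * expInf X 0 p.2 p.1 :=
    (hX.measurable_sub_expInf k).comp (((measurable_const (a := c)).prodMk
      measurable_snd).prodMk ((measurable_const (a := (0 : ℝ≥0∞))).prodMk measurable_fst))
  exact lintegral_lintegral_swap (f := fun ω T => k - c * expInf X 0 T ω) hm.aemeasurable

/-- No stopping time does better than the candidate value. -/
lemma IsLevy.infMean_mul_lintegral_discounted_le (hX : IsLevy P ℱ X) {r : ℝ} (hr : 0 ≤ r)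
    {κ : ℝ≥0∞} (hκ : κ ≠ ∞) {c : ℝ≥0} (hc : c ≠ 0) {τ : Ω → ℝ≥0∞} (hτ : IsStopTime ℱ τ) :
    infMean P X r * ∫⁻ ω, discounted X r c (fun z => κ - z) (τ ω) ω ∂P ≤
      infPut P X r (κ * infMean P X r) c := by
  have hm1 := ne_top_of_le_ne_top ENNReal.one_ne_top (hX.infMean_le_one hr)
  have hk : κ * infMean P X r ≠ ∞ := ENNReal.mul_ne_top hκ hm1
  rw [← lintegral_const_mul _ (hX.measurable_discounted r c
    (f := fun z => κ - z) (measurable_const.sub measurable_id) hτ.measurable),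
    ← hX.lintegral_lintegral_killLaw hr]
  calc ∫⁻ ω, infMean P X r * discounted X r c (fun z => κ - z) (τ ω) ω ∂P
      ≤ ∫⁻ ω, discounted X r c (infPut P X r (κ * infMean P X r)) (τ ω) ω ∂P := by
        refine lintegral_mono fun ω => ?_
        rw [mul_discounted, discounted, discounted]
        split_ifs
        · exact le_rfl
        · refine mul_le_mul_right ?_ _
          rw [hX.mul_infMean_sub hr]
          exact hX.sub_le_infPut hr _ _
    _ = ∫⁻ ω, ∫⁻ T, (κ * infMean P X r - c * expInf X (τ ω) T ω) ∂killLaw r ∂P :=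
        (hX.strongMarkov_expInf hr hk hc hτ).symm
    _ ≤ _ := lintegral_mono fun ω => lintegral_mono fun T =>
        tsub_le_tsub_left (mul_le_mul_right (expInf_mono zero_le ω) _) _

lemma IsLevy.mul_expPath_passTime_le (hX : IsLevy P ℱ X) {c : ℝ≥0} {k : ℝ≥0∞} {ω : Ω}
    (h : passTime X c k ω ≠ ∞) : c * expPath X (passTime X c k ω).toNNReal ω ≤ k := by
  have hex : ∀ n : ℕ, ∃ u : ℝ≥0, c * expPath X u ω < k ∧
      (u : ℝ≥0∞) < passTime X c k ω + ((1 / (n + 1) : ℝ≥0) : ℝ≥0∞) := fun n =>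
    passTime_lt_iff.1 (ENNReal.lt_add_right h (by simp))
  choose u hu1 hu2 using hex
  have hle : ∀ n, passTime X c k ω ≤ u n := fun n => iInf₂_le (u n) (hu1 n)
  generalize passTime X c k ω = σ at h hu2 hle
  lift σ to ℝ≥0 using h
  have ht : Tendsto u atTop (nhds σ) := by
    refine tendsto_of_tendsto_of_tendsto_of_le_of_le (h := fun n : ℕ => σ + 1 / ((n : ℝ≥0) + 1))
      tendsto_const_nhds ?_ (fun n => by exact_mod_cast hle n)
      (fun n => by exact_mod_cast (hu2 n).le)
    simpa using tendsto_const_nhds.add (tendsto_one_div_add_atTop_nhds_zero_nat (𝕜 := ℝ≥0))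
  have hY := hX.tendsto_expPath ht (fun n => by exact_mod_cast hle n) ω
  rw [ENNReal.toNNReal_coe]
  exact le_of_tendsto (ENNReal.Tendsto.const_mul hY (Or.inr ENNReal.coe_ne_top))
    (Eventually.of_forall fun n => (hu1 n).le)

lemma IsLevy.measurableSet_passTime_lt (hX : IsLevy P ℱ X) (c : ℝ≥0) (k : ℝ≥0∞) (v : ℝ≥0) :
    MeasurableSet[ℱ v] {ω | passTime X c k ω < v} := by
  have h : {ω | passTime X c k ω < v} = ⋃ p : ℕ × ℕ, ⋃ _ : (p.1 : ℝ≥0) / (p.2 + 1) < v,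
      {ω | c * expPath X ((p.1 : ℝ≥0) / (p.2 + 1)) ω < k} := by
    ext ω
    simp only [mem_ofPred_eq, mem_iUnion, exists_prop]
    rw [passTime_lt_iff]
    constructor
    · rintro ⟨u, hu, huv⟩
      have ht := ENNReal.Tendsto.const_mul (a := (c : ℝ≥0∞)) (hX.tendsto_expPath
        (tendsto_ceilTime u) (fun n => le_ceilTime n u) ω) (Or.inr ENNReal.coe_ne_top)
      obtain ⟨n, h1, h2⟩ := ((ht.eventually_lt_const hu).and
        ((tendsto_ceilTime u).eventually_lt_const (by exact_mod_cast huv))).exists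
      exact ⟨(⌈u * (n + 1)⌉₊, n), h2, h1⟩
    · rintro ⟨p, hp, h⟩
      exact ⟨_, h, by exact_mod_cast hp⟩
  rw [h]
  refine MeasurableSet.iUnion fun p => MeasurableSet.iUnion fun hp => ?_
  have hY : Measurable[ℱ v] (expPath X ((p.1 : ℝ≥0) / (p.2 + 1))) :=
    (hX.measurable_expPath _).mono (ℱ.mono (NNReal.coe_le_coe.2 hp.le)) le_rfl
  exact (hY.const_mul _) measurableSet_Iio

lemma IsLevy.isStopTime_passTime (hX : IsLevy P ℱ X) (c : ℝ≥0) (k : ℝ≥0∞) :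
    IsStopTime ℱ (passTime X c k) := by
  intro t ht
  rw [hX.filtRightCont t]
  simp only [MeasurableSpace.measurableSet_iInf]
  intro s hs
  have hts : t < s := hs
  have h : {ω | passTime X c k ω ≤ ENNReal.ofReal t} = ⋂ n : ℕ,
      {ω | passTime X c k ω < ((Real.toNNReal (t + (s - t) / (n + 1)) : ℝ≥0) : ℝ≥0∞)} := by
    ext ω
    simp only [mem_ofPred_eq, mem_iInter]
    constructor
    · intro h n
      refine h.trans_lt ?_
      have : 0 < (s - t) / (n + 1) := div_pos (sub_pos.2 hts) (by positivity)
      exact (ENNReal.ofReal_lt_ofReal_iff (by linarith)).2 (by linarith)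
    · intro h
      have hl : Tendsto (fun n : ℕ => ENNReal.ofReal (t + (s - t) / (n + 1))) atTop
          (nhds (ENNReal.ofReal t)) := by
        refine ENNReal.tendsto_ofReal ?_
        have h1 := (tendsto_one_div_add_atTop_nhds_zero_nat (𝕜 := ℝ)).const_mul (s - t)
        have h2 := h1.const_add t
        simpa [div_eq_mul_inv] using h2
      exact ge_of_tendsto hl (Eventually.of_forall fun n => (h n).le)
  rw [h]
  refine MeasurableSet.iInter fun n => ?_
  refine ℱ.mono ?_ _ (hX.measurableSet_passTime_lt c k _)
  have h1 : 0 ≤ (s - t) / (n + 1) := div_nonneg (sub_pos.2 hts).le (by positivity)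
  have h2 : (s - t) / (n + 1) ≤ s - t :=
    div_le_self (sub_pos.2 hts).le (by linarith [n.cast_nonneg (α := ℝ)])
  rw [Real.coe_toNNReal _ (by linarith)]
  linarith

/-- The first passage time attains the candidate value. -/
lemma IsLevy.infPut_le_lintegral_discounted_passTime (hX : IsLevy P ℱ X) {r : ℝ} (hr : 0 ≤ r)
    {κ : ℝ≥0∞} (hκ : κ ≠ ∞) {c : ℝ≥0} (hc : c ≠ 0) :
    infPut P X r (κ * infMean P X r) c ≤ infMean P X r * ∫⁻ ω, discounted X r c (fun z => κ - z)
      (passTime X c (κ * infMean P X r) ω) ω ∂P := by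
  have hm1 := ne_top_of_le_ne_top ENNReal.one_ne_top (hX.infMean_le_one hr)
  have hk : κ * infMean P X r ≠ ∞ := ENNReal.mul_ne_top hκ hm1
  have hσ := hX.isStopTime_passTime c (κ * infMean P X r)
  rw [← lintegral_const_mul _ (hX.measurable_discounted r c
    (f := fun z => κ - z) (measurable_const.sub measurable_id) hσ.measurable),
    ← hX.lintegral_lintegral_killLaw hr]
  calc _ ≤ ∫⁻ ω, ∫⁻ T, (κ * infMean P X r -
          c * expInf X (passTime X c (κ * infMean P X r) ω) T ω) ∂killLaw r ∂P :=
        lintegral_mono fun ω => lintegral_mono fun T => sub_expInf_le_passTime hc _ T ω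
    _ = _ := hX.strongMarkov_expInf hr hk hc hσ
    _ ≤ _ := by
        refine lintegral_mono fun ω => ?_
        rw [mul_discounted, discounted, discounted]
        split_ifs with h
        · exact le_rfl
        · rw [hX.mul_infMean_sub hr, hX.infPut_eq hr hk (hX.mul_expPath_passTime_le h)]

end OptimalStopping

section Conversion

variable {X : ℝ → Ω → ℝ}

lemma expInf_zero_eq {I : Set ℝ} {T : ℝ≥0∞} (h0 : (0 : ℝ) ∈ I)
    (hI : ∀ s, s ∈ I ↔ 0 ≤ s ∧ ENNReal.ofReal s ≤ T) {ω : Ω}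
    (hb : BddBelow ((fun s => X s ω) '' I)) :
    expInf X 0 T ω = ENNReal.ofReal (Real.exp (sInf ((fun s => X s ω) '' I))) := by
  refine le_antisymm ?_ (le_expInf fun u _ hu => ?_)
  · have hmono : Monotone fun y : ℝ => ENNReal.ofReal (Real.exp y) := fun a b hab =>
      ENNReal.ofReal_le_ofReal (Real.exp_le_exp.2 hab)
    have hcont : Continuous fun y : ℝ => ENNReal.ofReal (Real.exp y) :=
      ENNReal.continuous_ofReal.comp Real.continuous_exp
    have h := hmono.map_csInf_of_continuousAt (A := (fun s => X s ω) '' I)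
      hcont.continuousAt ⟨_, mem_image_of_mem _ h0⟩ hb
    rw [h]
    refine le_sInf ?_
    rintro _ ⟨_, ⟨s, hs, rfl⟩, rfl⟩
    obtain ⟨hs0, hsT⟩ := (hI s).1 hs
    lift s to ℝ≥0 using hs0
    exact expInf_le zero_le (by simpa using hsT)
  · refine ENNReal.ofReal_le_ofReal (Real.exp_le_exp.2 (csInf_le hb ?_))
    exact ⟨u, (hI u).2 ⟨u.2, by simpa using hu⟩, rfl⟩

lemma expInf_zero_ofReal {t : ℝ} (ht : 0 ≤ t) {ω : Ω}
    (hb : BddBelow ((fun s => X s ω) '' Icc 0 t)) :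
    expInf X 0 (ENNReal.ofReal t) ω = ENNReal.ofReal (Real.exp (runInf X t ω)) :=
  expInf_zero_eq (left_mem_Icc.2 ht)
    (fun s => by rw [mem_Icc, ENNReal.ofReal_le_ofReal_iff ht]) hb

lemma expInf_zero_top {ω : Ω} (hb : BddBelow ((fun s => X s ω) '' Ici 0)) :
    expInf X 0 ∞ ω = ENNReal.ofReal (Real.exp (infAll X ω)) :=
  expInf_zero_eq (mem_Ici.2 le_rfl) (fun s => by simp) hb

lemma integral_mul_toReal_eq_killLaw {r : ℝ} (hr : 0 < r) {Φ : ℝ≥0∞ → ℝ≥0∞} (hΦ : Measurable Φ)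
    (htop : ∀ T, Φ T ≠ ∞) :
    ∫ t in Ioi (0 : ℝ), r * Real.exp (-(r * t)) * (Φ (ENNReal.ofReal t)).toReal =
      (∫⁻ T, Φ T ∂killLaw r).toReal := by
  rw [lintegral_killLaw hr hΦ, ← integral_toReal]
  · refine integral_congr_ae (Eventually.of_forall fun t => ?_)
    simp only
    rw [ENNReal.toReal_mul, ENNReal.toReal_ofReal (by positivity)]
  · exact ((measurable_expDensity r).mul (hΦ.comp ENNReal.measurable_ofReal)).aemeasurable
  · exact Eventually.of_forall fun t => ENNReal.mul_lt_top ENNReal.ofReal_lt_top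
      (htop _).lt_top

lemma bddBelow_of_expInf_zero_top_ne_zero {ω : Ω} (h : expInf X 0 ∞ ω ≠ 0) :
    BddBelow ((fun s => X s ω) '' Ici 0) := by
  refine ⟨Real.log (expInf X 0 ∞ ω).toReal, ?_⟩
  rintro _ ⟨s, hs, rfl⟩
  have hs' : (0 : ℝ) ≤ s := hs
  lift s to ℝ≥0 using hs'
  have htop := expInf_zero_ne_top (X := X) ∞ ω
  rw [Real.log_le_iff_le_exp (ENNReal.toReal_pos h htop)]
  exact (ENNReal.le_ofReal_iff_toReal_le htop (Real.exp_pos _).le).1 (expInf_le zero_le le_top)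

lemma max_sub_exp_eq (k x y : ℝ) :
    max (k - Real.exp (x + y)) 0 = (ENNReal.ofReal k -
      (Real.toNNReal (Real.exp x) : ℝ≥0∞) * ENNReal.ofReal (Real.exp y)).toReal := by
  change _ = (ENNReal.ofReal k -
      ENNReal.ofReal (Real.exp x) * ENNReal.ofReal (Real.exp y)).toReal
  rw [← ENNReal.ofReal_mul (Real.exp_pos x).le, ← Real.exp_add,
    ← ENNReal.ofReal_sub _ (Real.exp_pos _).le, ENNReal.toReal_ofReal']

variable [m0 : MeasurableSpace Ω] {P : Measure Ω} {ℱ : Filtration ℝ m0}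

lemma IsLevy.bddBelow_Icc (hX : IsLevy P ℱ X) (t : ℝ) (ω : Ω) :
    BddBelow ((fun s => X s ω) '' Icc 0 t) := by
  refine isCompact_Icc.induction_on (p := fun S => BddBelow ((fun s => X s ω) '' S))
    (by simp) (fun _ _ hst h => h.mono (image_mono hst))
    (fun _ _ h1 h2 => by rw [image_union]; exact h1.union h2) fun s hs => ?_
  have key : ∃ a, ∀ᶠ u in nhdsWithin s (Icc 0 t), a ≤ X u ω := by
    have h1 := (hX.rightCont ω s hs.1).eventually_const_le (u := X s ω - 1) (by linarith)
    rcases hs.1.eq_or_lt with h0 | h0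
    · exact ⟨X s ω - 1, h1.filter_mono (nhdsWithin_mono s fun u hu => by
        rw [← h0]; exact hu.1)⟩
    · obtain ⟨l, hl⟩ := hX.leftLim ω s h0
      have h2 := hl.eventually_const_le (u := l - 1) (by linarith)
      refine ⟨min (X s ω - 1) (l - 1), Eventually.filter_mono nhdsWithin_le_nhds ?_⟩
      rw [← nhdsLT_sup_nhdsGE, eventually_sup]
      exact ⟨h2.mono fun _ h => (min_le_right _ _).trans h,
        h1.mono fun _ h => (min_le_left _ _).trans h⟩
  obtain ⟨a, ha⟩ := key
  refine ⟨_, ha, a, ?_⟩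
  rintro _ ⟨u, hu, rfl⟩
  exact hu

lemma IsLevy.bddBelow_Ici (hX : IsLevy P ℱ X) {ω : Ω}
    (hω : Tendsto (fun t => X t ω) atTop atTop) : BddBelow ((fun s => X s ω) '' Ici 0) := by
  obtain ⟨t, ht⟩ := eventually_atTop.1 (hω.eventually_ge_atTop 0)
  refine ((hX.bddBelow_Icc t ω).union (_root_.bddBelow_Ici (a := (0 : ℝ)))).mono ?_
  rintro _ ⟨s, hs, rfl⟩
  rcases le_total s t with h | h
  · exact Or.inl ⟨s, ⟨hs, h⟩, rfl⟩
  · exact Or.inr (ht s h)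

lemma IsLevy.ae_expInf_zero_top_ne_zero (hX : IsLevy P ℱ X)
    (h : P {ω | Tendsto (fun t => X t ω) atTop atTop} = 1) :
    ∀ᵐ ω ∂P, expInf X 0 ∞ ω ≠ 0 := by
  have := hX.isProb
  have hm : MeasurableSet {ω | expInf X 0 ∞ ω ≠ 0} :=
    (hX.measurable_expInf_zero ∞) (measurableSet_singleton (0 : ℝ≥0∞)).compl
  refine (prob_compl_eq_zero_iff hm).2 (le_antisymm prob_le_one ?_)
  rw [← h]
  refine measure_mono fun ω hω => ?_
  rw [mem_ofPred_eq, expInf_zero_top (hX.bddBelow_Ici hω)]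
  simp [Real.exp_pos]

lemma IsLevy.infMean_ne_zero (hX : IsLevy P ℱ X) {r : ℝ}
    (hr : 0 < r ∨ (r = 0 ∧ P {ω | Tendsto (fun t => X t ω) atTop atTop} = 1)) :
    infMean P X r ≠ 0 := by
  have := hX.isProb
  have hr0 : 0 ≤ r := hr.elim le_of_lt fun h => h.1.ge
  have := isProbabilityMeasure_killLaw hr0
  have hpos : ∀ᵐ T ∂killLaw r, ∀ᵐ ω ∂P, expInf X 0 T ω ≠ 0 := by
    rcases hr with hr | ⟨rfl, hlim⟩
    · have htop : killLaw r {∞} = 0 := by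
        rw [killLaw, if_pos hr, Measure.map_apply ENNReal.measurable_ofReal
          (measurableSet_singleton _)]
        have : ENNReal.ofReal ⁻¹' {∞} = ∅ := by ext t; simp
        rw [this, measure_empty]
      filter_upwards [measure_eq_zero_iff_ae_notMem.1 htop] with T hT
      refine Eventually.of_forall fun ω => ?_
      lift T to ℝ≥0 using hT
      rw [← ENNReal.ofReal_coe_nnreal, expInf_zero_ofReal T.coe_nonneg (hX.bddBelow_Icc T ω)]
      simp [Real.exp_pos]
    · rw [killLaw_zero, ae_dirac_eq]
      exact hX.ae_expInf_zero_top_ne_zero hlim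
  intro h0
  rw [infMean, lintegral_eq_zero_iff hX.measurable_lintegral_expInf] at h0
  obtain ⟨T, hT0, hT⟩ := (h0.and hpos).exists
  have hT0' : ∫⁻ ω, expInf X 0 T ω ∂P = 0 := hT0
  rw [lintegral_eq_zero_iff (hX.measurable_expInf_zero T)] at hT0'
  obtain ⟨ω, h1, h2⟩ := (hT0'.and hT).exists
  exact h2 h1

lemma IsLevy.integral_exp_runInf (hX : IsLevy P ℱ X) {t : ℝ} (ht : 0 ≤ t) :
    ∫ ω, Real.exp (runInf X t ω) ∂P = (∫⁻ ω, expInf X 0 (ENNReal.ofReal t) ω ∂P).toReal := by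
  rw [← integral_toReal (hX.measurable_expInf_zero _).aemeasurable
    (Eventually.of_forall fun ω => (expInf_zero_ne_top _ ω).lt_top)]
  refine integral_congr_ae (Eventually.of_forall fun ω => ?_)
  simp only
  rw [expInf_zero_ofReal ht (hX.bddBelow_Icc t ω), ENNReal.toReal_ofReal (Real.exp_pos _).le]

lemma IsLevy.mInf_eq (hX : IsLevy P ℱ X) {r : ℝ}
    (hr : 0 < r ∨ (r = 0 ∧ P {ω | Tendsto (fun t => X t ω) atTop atTop} = 1)) :
    mInf P X r = (infMean P X r).toReal := by
  rcases hr with hr | ⟨rfl, hlim⟩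
  · rw [mInf, if_pos hr, infMean, ← integral_mul_toReal_eq_killLaw hr
      hX.measurable_lintegral_expInf fun T => ne_top_of_le_ne_top ENNReal.one_ne_top
        (hX.lintegral_expInf_le_one T)]
    refine setIntegral_congr_fun measurableSet_Ioi fun t ht => ?_
    rw [hX.integral_exp_runInf (le_of_lt ht)]
  · rw [mInf, if_neg (lt_irrefl _), infMean, killLaw_zero, lintegral_dirac,
      ← integral_toReal (hX.measurable_expInf_zero _).aemeasurable
        (Eventually.of_forall fun ω => (expInf_zero_ne_top _ ω).lt_top)]
    refine integral_congr_ae ?_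
    filter_upwards [hX.ae_expInf_zero_top_ne_zero hlim] with ω hω
    rw [expInf_zero_top (bddBelow_of_expInf_zero_top_ne_zero hω),
      ENNReal.toReal_ofReal (Real.exp_pos _).le]

lemma IsLevy.integral_max_sub_exp (hX : IsLevy P ℱ X) (k x : ℝ) (T : ℝ≥0∞) {I : Ω → ℝ}
    (hI : ∀ᵐ ω ∂P, expInf X 0 T ω = ENNReal.ofReal (Real.exp (I ω))) :
    ∫ ω, max (k - Real.exp (x + I ω)) 0 ∂P = (∫⁻ ω, (ENNReal.ofReal k -
      (Real.toNNReal (Real.exp x) : ℝ≥0∞) * expInf X 0 T ω) ∂P).toReal := by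
  have hm : Measurable fun ω => ENNReal.ofReal k -
      (Real.toNNReal (Real.exp x) : ℝ≥0∞) * expInf X 0 T ω :=
    measurable_const.sub ((hX.measurable_expInf_zero T).const_mul _)
  rw [← integral_toReal hm.aemeasurable
    (Eventually.of_forall fun ω => tsub_le_self.trans_lt ENNReal.ofReal_lt_top)]
  refine integral_congr_ae ?_
  filter_upwards [hI] with ω hω
  rw [hω, max_sub_exp_eq]

lemma IsLevy.put_integral_eq_infPut (hX : IsLevy P ℱ X) {r : ℝ}
    (hr : 0 < r ∨ (r = 0 ∧ P {ω | Tendsto (fun t => X t ω) atTop atTop} = 1)) (k x : ℝ) :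
    (if 0 < r then
        ∫ t in Set.Ioi (0 : ℝ), r * Real.exp (-(r * t)) *
          (∫ ω, max (k - Real.exp (x + runInf X t ω)) 0 ∂P)
       else ∫ ω, max (k - Real.exp (x + infAll X ω)) 0 ∂P) =
      (infPut P X r (ENNReal.ofReal k) (Real.toNNReal (Real.exp x))).toReal := by
  have := hX.isProb
  rcases hr with hr | ⟨rfl, hlim⟩
  · have hm : Measurable fun T => ∫⁻ ω, (ENNReal.ofReal k -
        (Real.toNNReal (Real.exp x) : ℝ≥0∞) * expInf X 0 T ω) ∂P :=
      (hX.measurable_lintegral_sub_expInf (ENNReal.ofReal k)).comp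
      (measurable_prodMk_left (x := (Real.toNNReal (Real.exp x) : ℝ≥0∞)))
    have htop : ∀ T, ∫⁻ ω, (ENNReal.ofReal k -
        (Real.toNNReal (Real.exp x) : ℝ≥0∞) * expInf X 0 T ω) ∂P ≠ ∞ := fun T => by
      refine ne_top_of_le_ne_top (b := ∫⁻ _, ENNReal.ofReal k ∂P) (by simp) ?_
      exact lintegral_mono fun ω => tsub_le_self
    rw [if_pos hr, infPut, ← integral_mul_toReal_eq_killLaw hr hm htop]
    refine setIntegral_congr_fun measurableSet_Ioi fun t ht => ?_
    rw [hX.integral_max_sub_exp k x (ENNReal.ofReal t) (Eventually.of_forall fun ω =>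
      expInf_zero_ofReal (le_of_lt ht) (hX.bddBelow_Icc t ω))]
  · rw [if_neg (lt_irrefl _), infPut, killLaw_zero, lintegral_dirac]
    refine hX.integral_max_sub_exp k x ∞ ?_
    filter_upwards [hX.ae_expInf_zero_top_ne_zero hlim] with ω hω
    exact expInf_zero_top (bddBelow_of_expInf_zero_top_ne_zero hω)

lemma IsLevy.integral_putPayoff (hX : IsLevy P ℱ X) {r : ℝ} (hr : 0 ≤ r) (K x : ℝ)
    {τ : Ω → ℝ≥0∞} (hτ : IsStopTime ℱ τ) :
    ∫ ω, putPayoff X r K x τ ω ∂P = (∫⁻ ω, discounted X r (Real.toNNReal (Real.exp x))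
      (fun z => ENNReal.ofReal K - z) (τ ω) ω ∂P).toReal := by
  rw [← integral_toReal (hX.measurable_discounted r _ (f := fun z => ENNReal.ofReal K - z)
    (measurable_const.sub measurable_id) hτ.measurable).aemeasurable
    (Eventually.of_forall fun ω => (discounted_le hr (fun z => tsub_le_self) _ ω).trans_lt
      ENNReal.ofReal_lt_top)]
  refine integral_congr_ae (Eventually.of_forall fun ω => ?_)
  simp only [putPayoff, stopPayoff, discounted]
  by_cases h : τ ω = ∞
  · simp [h]
  · rw [if_pos h, if_neg h, ENNReal.toReal_mul, ENNReal.toReal_ofReal (Real.exp_pos _).le,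
      expPath, ← max_sub_exp_eq]
    rfl

end Conversion

theorem stmt9 [m0 : MeasurableSpace Ω] (P : Measure Ω) (ℱ : Filtration ℝ m0)
    (X : ℝ → Ω → ℝ) (hX : IsLevy P ℱ X) (r K : ℝ) (hK : 0 < K)
    (hr : 0 < r ∨ (r = 0 ∧ P {ω | Tendsto (fun t => X t ω) atTop atTop} = 1))
    (x : ℝ) :
    putValue P ℱ X r K x =
      (if 0 < r then
        ∫ t in Set.Ioi (0 : ℝ), r * Real.exp (-(r * t)) *
          (∫ ω, max (K * mInf P X r - Real.exp (x + runInf X t ω)) 0 ∂P)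
       else ∫ ω, max (K * mInf P X r - Real.exp (x + infAll X ω)) 0 ∂P) / mInf P X r := by
  have := hX.isProb
  have hr0 : 0 ≤ r := hr.elim le_of_lt fun h => h.1.ge
  have hm0 := hX.infMean_ne_zero hr
  have hm1 := ne_top_of_le_ne_top ENNReal.one_ne_top (hX.infMean_le_one hr0)
  have hc : Real.toNNReal (Real.exp x) ≠ 0 := by simp [Real.exp_pos]
  have hκ : ENNReal.ofReal K ≠ ∞ := ENNReal.ofReal_ne_top
  have hk : ENNReal.ofReal (K * (infMean P X r).toReal) = ENNReal.ofReal K * infMean P X r := by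
    rw [ENNReal.ofReal_mul hK.le, ENNReal.ofReal_toReal hm1]
  rw [hX.mInf_eq hr, hX.put_integral_eq_infPut hr, hk, ← ENNReal.toReal_div, putValue]
  have hV : infPut P X r (ENNReal.ofReal K * infMean P X r) (Real.toNNReal (Real.exp x)) /
      infMean P X r ≠ ∞ :=
    ENNReal.div_ne_top (ne_top_of_le_ne_top (ENNReal.mul_ne_top hκ hm1) (hX.infPut_le hr0 _ _)) hm0
  have hle : ∀ τ : {τ : Ω → ℝ≥0∞ // IsStopTime ℱ τ}, ∫ ω, putPayoff X r K x τ.1 ω ∂P ≤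
      (infPut P X r (ENNReal.ofReal K * infMean P X r) (Real.toNNReal (Real.exp x)) /
        infMean P X r).toReal := fun τ => by
    rw [hX.integral_putPayoff hr0 K x τ.2]
    refine ENNReal.toReal_mono hV ?_
    rw [ENNReal.le_div_iff_mul_le (Or.inl hm0) (Or.inl hm1), mul_comm]
    exact hX.infMean_mul_lintegral_discounted_le hr0 hκ hc τ.2
  let σ : {τ : Ω → ℝ≥0∞ // IsStopTime ℱ τ} := ⟨_, hX.isStopTime_passTime
    (Real.toNNReal (Real.exp x)) (ENNReal.ofReal K * infMean P X r)⟩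
  have : Nonempty {τ : Ω → ℝ≥0∞ // IsStopTime ℱ τ} := ⟨σ⟩
  refine le_antisymm (ciSup_le hle) (le_ciSup_of_le ⟨_, forall_mem_range.2 hle⟩ σ ?_)
  rw [hX.integral_putPayoff hr0 K x σ.2]
  refine ENNReal.toReal_mono ?_ ?_
  · refine ne_top_of_le_ne_top (b := ∫⁻ _, ENNReal.ofReal K ∂P) (by simp)
      (lintegral_mono fun ω => discounted_le hr0 (fun z => tsub_le_self) _ ω)
  · rw [ENNReal.div_le_iff' hm0 hm1]
    exact hX.infPut_le_lintegral_discounted_passTime hr0 hκ hc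

end AKLevy
end
end
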